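/- arXiv:2311.03845 — 14 statements merged into one kernel-verified Lean document; each statement's English description precedes it below -/
import Mathlib

section
/- Let S ⊆ ℤ[X] be a finite set of polynomials and let a ∈ ℤ with a ∉ I(S). Let T be an m×n integer matrix, u ∈ ℤ^m, v ∈ ℤ^n, and suppose that every entry C(T i j) + X * C(u i * v j) of the associated m×n matrix over ℤ[X] lies in S. If the integer matrix with entries T i j + a * u i * v j is totally S(a)-modular, then T is totally S(0)-modular, where S(a) = {s.eval a : s ∈ S} and S(0) = {s.eval 0 : s ∈ S}. -/
open Polynomial Matrix

/-- `M` is totally `S`-modular: every `k × k` subdeterminant (taken along strictly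
monotone row/column selections) lies in `S`, for all `1 ≤ k ≤ min m n`. -/
def IsTotallySModular {R : Type*} [CommRing R] {m n : ℕ}
    (S : Set R) (M : Matrix (Fin m) (Fin n) R) : Prop :=
  ∀ k : ℕ, 1 ≤ k → k ≤ min m n →
    ∀ f : Fin k → Fin m, ∀ g : Fin k → Fin n, StrictMono f → StrictMono g →
      (M.submatrix f g).det ∈ S

/-- An `l × l` matrix (`l ≥ 2`) is a forbidden minor for `S` if every
`(l-1) × (l-1)` submatrix is totally `S`-modular but its determinant is not in `S`. -/
def IsForbiddenMinor {R : Type*} [CommRing R] {l : ℕ}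
    (S : Set R) (M : Matrix (Fin l) (Fin l) R) : Prop :=
  2 ≤ l ∧
  (∀ f : Fin (l - 1) → Fin l, ∀ g : Fin (l - 1) → Fin l,
      StrictMono f → StrictMono g → IsTotallySModular S (M.submatrix f g)) ∧
  M.det ∉ S

/-- The set of determinants of forbidden minors for `S` of all sizes. -/
def FSet (S : Set (Polynomial ℤ)) : Set (Polynomial ℤ) :=
  {p | ∃ l : ℕ, ∃ M : Matrix (Fin l) (Fin l) (Polynomial ℤ),
        IsForbiddenMinor S M ∧ M.det = p}

/-- Integer points where a polynomial in `S` and a polynomial in `F(S)` agree. -/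
def ISet (S : Set (Polynomial ℤ)) : Set ℤ :=
  {a | ∃ s ∈ S, ∃ f ∈ FSet S, s.eval a = f.eval a}

/-- If every entry of a polynomial matrix lies in `S`, its evaluation at `a` is totally
`S(a)`-modular and `a ∉ I(S)`, then the matrix itself is totally `S`-modular. -/
theorem isTotallySModular_of_eval {m n : ℕ} {S : Set ℤ[X]} {a : ℤ} (ha : a ∉ ISet S)
    {P : Matrix (Fin m) (Fin n) ℤ[X]} (hP : ∀ i j, P i j ∈ S)
    (h : IsTotallySModular ((fun s : ℤ[X] => s.eval a) '' S) (P.map (eval a))) :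
    IsTotallySModular S P := by
  intro k
  induction k using Nat.strong_induction_on with
  | _ k ih =>
    intro hk1 hk f g hf hg
    obtain rfl | hk2 : k = 1 ∨ 2 ≤ k := by lia
    · simpa using hP (f 0) (g 0)
    by_contra hdet
    obtain ⟨s, hs, hsa⟩ := h k hk1 hk f g hf hg
    refine ha ⟨s, hs, _, ⟨k, P.submatrix f g, ⟨hk2, ?_, hdet⟩, rfl⟩, ?_⟩
    · intro f' g' hf' hg' j hj1 hj f'' g'' hf'' hg''
      exact ih j (by lia) hj1 (by lia) _ _ (hf.comp (hf'.comp hf'')) (hg.comp (hg'.comp hg''))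
    · exact hsa.trans ((evalRingHom a).map_det (P.submatrix f g)).symm

theorem stmt1 {m n : ℕ} (S : Set (Polynomial ℤ)) (hS : S.Finite)
    (a : ℤ) (ha : a ∉ ISet S)
    (T : Matrix (Fin m) (Fin n) ℤ) (u : Fin m → ℤ) (v : Fin n → ℤ)
    (hentries : ∀ i j,
      Polynomial.C (T i j) + Polynomial.X * Polynomial.C (u i * v j) ∈ S)
    (h : IsTotallySModular ((fun s : Polynomial ℤ => s.eval a) '' S)
          (Matrix.of fun i j => T i j + a * (u i * v j))) :
    IsTotallySModular ((fun s : Polynomial ℤ => s.eval 0) '' S) T := by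
  have hP : IsTotallySModular S
      (Matrix.of fun i j => C (T i j) + X * C (u i * v j) : Matrix (Fin m) (Fin n) ℤ[X]) := by
    refine isTotallySModular_of_eval ha hentries ?_
    convert h using 1
    ext i j
    simp
  intro k hk1 hk f g hf hg
  refine ⟨_, hP k hk1 hk f g hf hg, ?_⟩
  refine ((evalRingHom (0 : ℤ)).map_det _).trans (congrArg Matrix.det ?_)
  ext i j
  simp
end

section
/- Let S ⊆ ℤ[X] be a finite set of polynomials. Then the set F(S) = {p ∈ ℤ[X] : there exist l ≥ 2 and an l×l matrix M over ℤ[X] such that M is a forbidden minor for S and det M = p} is finite. -/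
open Polynomial Matrix

/-- The Desnanot–Jacobi identity, multiplied by `det M`. -/
theorem det_mul_adjugate_minor {R : Type*} [CommRing R] {m : ℕ}
    (M : Matrix (Fin (m + 2)) (Fin (m + 2)) R) :
    M.det * (M.adjugate 0 0 * M.adjugate 1 1 - M.adjugate 0 1 * M.adjugate 1 0) =
      M.det ^ 2 * (M.submatrix (fun i : Fin m => i.succ.succ) (fun i => i.succ.succ)).det := by
  let e : Fin 2 ⊕ Fin m ≃ Fin (m + 2) := finSumFinEquiv.trans (finCongr (add_comm 2 m))
  have hr : ∀ i : Fin m, e (Sum.inr i) = i.succ.succ := fun i => by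
    ext; simp [e]
  have h0 : e (Sum.inl 0) = 0 := by ext; simp [e]
  have h1 : e (Sum.inl 1) = 1 := by ext; simp [e]
  have hmul : M.submatrix e e * M.adjugate.submatrix e e = M.det • 1 := by
    rw [submatrix_mul_equiv, mul_adjugate]
    ext i j
    simp [one_apply]
  rw [← fromBlocks_toBlocks (M.submatrix e e), ← fromBlocks_toBlocks (M.adjugate.submatrix e e),
    fromBlocks_multiply, ← fromBlocks_one, fromBlocks_smul, fromBlocks_inj] at hmul
  obtain ⟨h11, -, h21, -⟩ := hmul
  have key : M.submatrix e e *
      fromBlocks (M.adjugate.submatrix e e).toBlocks₁₁ 0 (M.adjugate.submatrix e e).toBlocks₂₁ 1 =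
      fromBlocks (M.det • 1) (M.submatrix e e).toBlocks₁₂ 0 (M.submatrix e e).toBlocks₂₂ := by
    conv_lhs => rw [← fromBlocks_toBlocks (M.submatrix e e)]
    rw [fromBlocks_multiply, h11, h21]
    simp
  have hdet := congrArg det key
  rw [det_mul, det_submatrix_equiv_self, det_fromBlocks_zero₁₂, det_fromBlocks_zero₂₁, det_one,
    mul_one, det_smul, det_one, mul_one, Fintype.card_fin, det_fin_two] at hdet
  have hT : (M.submatrix e e).toBlocks₂₂ =
      M.submatrix (fun i : Fin m => i.succ.succ) (fun i => i.succ.succ) := by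
    ext i j
    simp [toBlocks₂₂, hr]
  rw [hT] at hdet
  simpa [toBlocks₁₁, h0, h1] using hdet

/-- A nonzero determinant has a nonzero term in its expansion along the first row. -/
theorem exists_det_succAbove_ne_zero {R : Type*} [CommRing R] {n : ℕ}
    {M : Matrix (Fin (n + 1)) (Fin (n + 1)) R} (h : M.det ≠ 0) :
    ∃ j : Fin (n + 1), (M.submatrix Fin.succ j.succAbove).det ≠ 0 := by
  contrapose! h
  rw [det_succ_row_zero]
  simp [h]

/-- Permuting columns changes a determinant at most by a sign. -/
theorem det_submatrix_right_eq_or_neg {R : Type*} [CommRing R] {n : ℕ}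
    (M : Matrix (Fin n) (Fin n) R) (σ : Equiv.Perm (Fin n)) :
    (M.submatrix id σ).det = M.det ∨ (M.submatrix id σ).det = -M.det := by
  rw [det_permute']
  rcases Int.units_eq_one_or (Equiv.Perm.sign σ) with h | h <;> simp [h]

/-- Minors along a strictly monotone row selection and an injective column selection agree
up to sign with minors along strictly monotone selections. -/
theorem det_submatrix_mem_of_injective {R : Type*} [CommRing R] {k m n : ℕ} {S : Set R}
    {M : Matrix (Fin m) (Fin n) R} {f : Fin k → Fin m}
    (hM : ∀ g : Fin k → Fin n, StrictMono g → (M.submatrix f g).det ∈ S)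
    {g : Fin k → Fin n} (hg : Function.Injective g) :
    (M.submatrix f g).det ∈ S ∨ -(M.submatrix f g).det ∈ S := by
  have hmono : StrictMono (g ∘ Tuple.sort g) :=
    (Tuple.monotone_sort g).strictMono_of_injective (hg.comp (Tuple.sort g).injective)
  have hmem := hM _ hmono
  have hcomp : M.submatrix f (g ∘ Tuple.sort g) =
      (M.submatrix f g).submatrix id (Tuple.sort g) := rfl
  rw [hcomp] at hmem
  rcases det_submatrix_right_eq_or_neg (M.submatrix f g) (Tuple.sort g) with h | h <;>
    rw [h] at hmem <;> tauto

/-- There is a permutation of `Fin (m + 2)` listing `i`, then `i.succAbove j`, then all the others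
in increasing order. -/
theorem exists_perm_succ_succ {m : ℕ} (i : Fin (m + 2)) (j : Fin (m + 1)) :
    ∃ σ : Equiv.Perm (Fin (m + 2)), ∀ k : Fin m, σ k.succ.succ = i.succAbove (j.succAbove k) := by
  have hinj : Function.Injective
      (Fin.cons i (i.succAbove ∘ (Fin.cons j j.succAbove : Fin (m + 1) → Fin (m + 1))) :
        Fin (m + 2) → Fin (m + 2)) := by
    refine Fin.cons_injective_iff.2 ⟨?_, Fin.succAbove_right_injective.comp
      (Fin.cons_injective_iff.2 ⟨?_, Fin.succAbove_right_injective⟩)⟩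
    · rintro ⟨k, hk⟩
      exact Fin.succAbove_ne _ _ hk
    · rintro ⟨k, hk⟩
      exact Fin.succAbove_ne _ _ hk
  exact ⟨Equiv.ofBijective _ (Finite.injective_iff_bijective.1 hinj), fun k => rfl⟩

/-- A nonzero determinant of a forbidden minor solves a linear equation whose coefficients are,
up to sign, built from elements of `S ∪ {1}`. -/
theorem IsForbiddenMinor.exists_det_mul_eq {R : Type*} [CommRing R] [IsDomain R] {l : ℕ}
    {S : Set R} {M : Matrix (Fin l) (Fin l) R} (hM : IsForbiddenMinor S M) (h : M.det ≠ 0) :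
    ∃ e ∈ S ∪ {1}, e ≠ 0 ∧ ∃ a ∈ S ∪ -S, ∃ b ∈ S ∪ -S, ∃ c ∈ S ∪ -S, ∃ d ∈ S ∪ -S,
      M.det * e = a * b - c * d ∨ M.det * e = -(a * b - c * d) := by
  obtain ⟨hl, hsub, -⟩ := hM
  obtain ⟨m, rfl⟩ := Nat.exists_eq_add_of_le' hl
  replace hsub : ∀ f g : Fin (m + 1) → Fin (m + 2), StrictMono f → StrictMono g →
    IsTotallySModular S (M.submatrix f g) := hsub
  obtain ⟨i, hi⟩ := exists_det_succAbove_ne_zero h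
  obtain ⟨j, hj⟩ := exists_det_succAbove_ne_zero hi
  obtain ⟨σ, hσ⟩ := exists_perm_succ_succ i j
  set N := M.submatrix id σ with hN
  have hmin : N.submatrix (fun k : Fin m => k.succ.succ) (fun k => k.succ.succ) =
      (M.submatrix Fin.succ i.succAbove).submatrix Fin.succ j.succAbove := by
    ext a b
    simp [hN, hσ]
  have hadj : ∀ a b, N.adjugate a b ∈ S ∪ -S := by
    intro a b
    have hcol : Function.Injective (σ ∘ a.succAbove) :=
      σ.injective.comp Fin.succAbove_right_injective
    have hmem := det_submatrix_mem_of_injective (S := S) (M := M) (f := b.succAbove)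
      (fun g hg => by
        simpa using hsub _ g (Fin.strictMono_succAbove b) hg (m + 1) (by omega) (by simp)
          id id strictMono_id strictMono_id) hcol
    have hcomp : M.submatrix b.succAbove (σ ∘ a.succAbove) =
      N.submatrix b.succAbove a.succAbove := rfl
    rw [hcomp] at hmem
    rw [adjugate_fin_succ_eq_det_submatrix]
    rcases neg_one_pow_eq_or R (b + a : ℕ) with hs | hs <;> rw [hs] <;>
      simp only [one_mul, neg_mul, Set.mem_union, Set.mem_neg, neg_neg] <;> tauto
  have hdet : N.det = M.det ∨ N.det = -M.det := det_submatrix_right_eq_or_neg M σ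
  have hN0 : N.det ≠ 0 := by
    rcases hdet with h' | h' <;> rw [h'] <;> simpa using h
  have hdj := det_mul_adjugate_minor N
  rw [pow_two, mul_assoc, hmin] at hdj
  replace hdj := mul_left_cancel₀ hN0 hdj
  refine ⟨_, ?_, hj, _, hadj 0 0, _, hadj 1 1, _, hadj 0 1, _, hadj 1 0, ?_⟩
  · rcases Nat.eq_zero_or_pos m with rfl | hm
    · right
      simp
    · left
      exact hsub _ _ (Fin.strictMono_succ) (Fin.strictMono_succAbove i) m hm (by simp) _ _
        (Fin.strictMono_succ) (Fin.strictMono_succAbove j)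
  · rw [hdj]
    rcases hdet with h' | h' <;> rw [h']
    · exact Or.inl rfl
    · right
      ring

open scoped Pointwise in
theorem stmt2 (S : Set (Polynomial ℤ)) (hS : S.Finite) :
    Set.Finite {p : Polynomial ℤ | ∃ l : ℕ, ∃ M : Matrix (Fin l) (Fin l) (Polynomial ℤ),
        IsForbiddenMinor S M ∧ M.det = p} := by
  have hU : (S ∪ -S).Finite := hS.union hS.neg
  set V := (S ∪ -S) * (S ∪ -S) - (S ∪ -S) * (S ∪ -S)
  have hV : (V ∪ -V).Finite := ((hU.mul hU).sub (hU.mul hU)).union ((hU.mul hU).sub (hU.mul hU)).neg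
  have hfin : (⋃ e ∈ (S ∪ {1}) \ {0}, (fun p => p * e) ⁻¹' (V ∪ -V)).Finite :=
    ((hS.union (Set.finite_singleton 1)).sdiff).biUnion fun e he =>
      hV.preimage (mul_left_injective₀ he.2).injOn
  refine (hfin.union (Set.finite_singleton 0)).subset ?_
  rintro p ⟨l, M, hM, rfl⟩
  by_cases h : M.det = 0
  · exact Or.inr h
  obtain ⟨e, he, he0, a, ha, b, hb, c, hc, d, hd, heq⟩ := hM.exists_det_mul_eq h
  have hmem : a * b - c * d ∈ V := Set.sub_mem_sub (Set.mul_mem_mul ha hb) (Set.mul_mem_mul hc hd)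
  refine Or.inl (Set.mem_biUnion ⟨he, he0⟩ ?_)
  rcases heq with heq | heq
  · left
    simpa [heq] using hmem
  · right
    simpa [heq] using hmem
end

section
/- Let S ⊆ ℤ be a finite set of integers and let τ ∈ ℤ satisfy |s| ≤ τ for all s ∈ S. If M is an l×l integer matrix with l ≥ 2 that is a forbidden minor for S, then |det M| ≤ 2 * τ^2. -/
open Polynomial Matrix

namespace Matrix

/-- The minor of `N` obtained by bordering the lower right block with the row `i` and the
column `j`. -/
def borderedMinor {R : Type*} [CommRing R] {p ι : Type*} [Fintype ι] [DecidableEq ι]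
    (N : Matrix (p ⊕ ι) (p ⊕ ι) R) (i j : p) : R :=
  (N.submatrix (Sum.map (fun _ : Unit => i) id) (Sum.map (fun _ : Unit => j) id)).det

theorem borderedMinor_eq_det_mul_schur {K : Type*} [Field K] {p ι : Type*} [Fintype ι]
    [DecidableEq ι] (N : Matrix (p ⊕ ι) (p ⊕ ι) K) (hN : N.toBlocks₂₂.det ≠ 0) (i j : p) :
    N.borderedMinor i j = N.toBlocks₂₂.det *
      (N.toBlocks₁₁ - N.toBlocks₁₂ * N.toBlocks₂₂⁻¹ * N.toBlocks₂₁) i j := by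
  have : Invertible N.toBlocks₂₂ := N.toBlocks₂₂.invertibleOfIsUnitDet hN.isUnit
  have hb : N.submatrix (Sum.map (fun _ : Unit => i) id) (Sum.map (fun _ : Unit => j) id) =
      fromBlocks (N.toBlocks₁₁.submatrix (fun _ => i) (fun _ => j))
        (N.toBlocks₁₂.submatrix (fun _ => i) id) (N.toBlocks₂₁.submatrix id (fun _ => j))
        N.toBlocks₂₂ := by
    ext (a | a) (b | b) <;> rfl
  rw [borderedMinor, hb, det_fromBlocks₂₂, det_unique (n := Unit), invOf_eq_nonsing_inv]
  rfl

/-- The Desnanot–Jacobi identity, when the complementary minor is nonzero in a field. -/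
theorem det_mul_det_toBlocks₂₂ {K : Type*} [Field K] {ι : Type*} [Fintype ι]
    [DecidableEq ι] (N : Matrix (Fin 2 ⊕ ι) (Fin 2 ⊕ ι) K) (hN : N.toBlocks₂₂.det ≠ 0) :
    N.det * N.toBlocks₂₂.det =
      N.borderedMinor 0 0 * N.borderedMinor 1 1 - N.borderedMinor 0 1 * N.borderedMinor 1 0 := by
  have : Invertible N.toBlocks₂₂ := N.toBlocks₂₂.invertibleOfIsUnitDet hN.isUnit
  have h := det_fromBlocks₂₂ N.toBlocks₁₁ N.toBlocks₁₂ N.toBlocks₂₁ N.toBlocks₂₂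
  rw [fromBlocks_toBlocks, det_fin_two, invOf_eq_nonsing_inv] at h
  simp only [borderedMinor_eq_det_mul_schur N hN, h]
  ring

theorem det_mul_det_toBlocks₂₂_int {ι : Type*} [Fintype ι] [DecidableEq ι]
    (N : Matrix (Fin 2 ⊕ ι) (Fin 2 ⊕ ι) ℤ) (hN : N.toBlocks₂₂.det ≠ 0) :
    N.det * N.toBlocks₂₂.det =
      N.borderedMinor 0 0 * N.borderedMinor 1 1 - N.borderedMinor 0 1 * N.borderedMinor 1 0 := by
  have hD : (N.map (Int.cast : ℤ → ℚ)).toBlocks₂₂.det = (N.toBlocks₂₂.det : ℤ) :=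
    (Int.cast_det N.toBlocks₂₂).symm
  have hb (i j : Fin 2) : (N.map (Int.cast : ℤ → ℚ)).borderedMinor i j = N.borderedMinor i j :=
    (Int.cast_det _).symm
  have h := det_mul_det_toBlocks₂₂ (N.map (Int.cast : ℤ → ℚ)) (by rw [hD]; exact_mod_cast hN)
  rw [hD, ← Int.cast_det] at h
  simp only [hb] at h
  exact_mod_cast h

theorem exists_det_submatrix_succAbove_ne_zero {R : Type*} [CommRing R] {m : ℕ}
    (M : Matrix (Fin (m + 1)) (Fin (m + 1)) R) (hM : M.det ≠ 0) :
    ∃ j : Fin (m + 1), (M.submatrix Fin.succ j.succAbove).det ≠ 0 := by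
  by_contra! h
  exact hM (by simp [det_succ_row_zero, h])

end Matrix

theorem Function.Injective.exists_strictMono_comp_perm {k : ℕ} {α : Type*} [LinearOrder α]
    {f : Fin k → α} (hf : f.Injective) : ∃ σ : Equiv.Perm (Fin k), StrictMono (f ∘ σ) :=
  ⟨Tuple.sort f, (Tuple.monotone_sort f).strictMono_of_injective
    (hf.comp (Tuple.sort f).injective)⟩

theorem StrictMono.exists_eq_succAbove_comp {k m : ℕ} (hk : k ≤ m) {f : Fin k → Fin (m + 1)}
    (hf : StrictMono f) :
    ∃ (p : Fin (m + 1)) (f' : Fin k → Fin m), StrictMono f' ∧ f = p.succAbove ∘ f' := by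
  have hns : ¬ Function.Surjective f := fun h => by
    have := Fintype.card_le_of_surjective f h
    simp at this
    omega
  obtain ⟨p, hp⟩ := not_forall.1 hns
  have hne (i : Fin k) : ∃ z, p.succAbove z = f i :=
    Fin.exists_succAbove_eq fun h => hp ⟨i, h⟩
  choose f' hf' using hne
  refine ⟨p, f', fun a b hab => ?_, funext fun i => (hf' i).symm⟩
  rw [← p.succAbove_lt_succAbove_iff, hf', hf']
  exact hf hab

/-- Every proper minor of a forbidden minor for `S` obeys the bound on `|s|`, `s ∈ S`. -/
theorem IsForbiddenMinor.abs_det_submatrix_le {S : Set ℤ} {τ : ℤ} (hτ : ∀ s ∈ S, |s| ≤ τ)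
    {m : ℕ} {M : Matrix (Fin (m + 1)) (Fin (m + 1)) ℤ} (hM : IsForbiddenMinor S M)
    {ι : Type*} [Fintype ι] [DecidableEq ι] [Nonempty ι] (hι : Fintype.card ι ≤ m)
    {f g : ι → Fin (m + 1)} (hf : f.Injective) (hg : g.Injective) :
    |(M.submatrix f g).det| ≤ τ := by
  let e := (Fintype.equivFin ι).symm
  obtain ⟨σ, hσ⟩ := (hf.comp e.injective).exists_strictMono_comp_perm
  obtain ⟨ρ, hρ⟩ := (hg.comp e.injective).exists_strictMono_comp_perm
  obtain ⟨p, f', hf', hpf⟩ := hσ.exists_eq_succAbove_comp hι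
  obtain ⟨q, g', hg', hqg⟩ := hρ.exists_eq_succAbove_comp hι
  have hmem := hM.2.1 p.succAbove q.succAbove p.strictMono_succAbove q.strictMono_succAbove
    (Fintype.card ι) Fintype.card_pos (by simpa using hι) f' g' hf' hg'
  rw [Matrix.submatrix_submatrix, ← hpf, ← hqg] at hmem
  rw [← Matrix.abs_det_submatrix_equiv_equiv (σ.trans e) (ρ.trans e)]
  exact hτ _ hmem

theorem stmt3 (S : Set ℤ) (hS : S.Finite) (τ : ℤ) (hτ : ∀ s ∈ S, |s| ≤ τ)
    {l : ℕ} (hl : 2 ≤ l) (M : Matrix (Fin l) (Fin l) ℤ)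
    (hM : IsForbiddenMinor S M) :
    |M.det| ≤ 2 * τ ^ 2 := by
  obtain ⟨n, rfl⟩ := Nat.exists_eq_add_of_le' hl
  by_cases h0 : M.det = 0
  · rw [h0, abs_zero]
    positivity
  obtain ⟨j, hj⟩ := M.exists_det_submatrix_succAbove_ne_zero h0
  obtain ⟨j', hj'⟩ := Matrix.exists_det_submatrix_succAbove_ne_zero _ hj
  -- Both index sets are enumerated so that the nonzero minor is the lower right block.
  have hsplit (q : Fin (n + 2)) (q' : Fin (n + 1)) : ∃ e : Fin 2 ⊕ Fin n ≃ Fin (n + 2),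
      e ∘ Sum.inr = q.succAbove ∘ q'.succAbove := by
    have hinj : Function.Injective
        (Sum.elim ![q, q.succAbove q'] (q.succAbove ∘ q'.succAbove)) := by
      refine Function.Injective.sumElim ?_
        (Fin.succAbove_right_injective.comp Fin.succAbove_right_injective) ?_
      · intro a b
        fin_cases a <;> fin_cases b <;> simp
      · intro a b
        fin_cases a <;> simp [Fin.ne_succAbove]
    exact ⟨Equiv.ofBijective _ ((Fintype.bijective_iff_injective_and_card _).2
      ⟨hinj, by simp [add_comm]⟩), rfl⟩
  obtain ⟨r, hr⟩ := hsplit 0 0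
  obtain ⟨c, hc⟩ := hsplit j j'
  have hD : (M.submatrix r c).toBlocks₂₂.det ≠ 0 := by
    have : (M.submatrix r c).toBlocks₂₂ = M.submatrix (r ∘ Sum.inr) (c ∘ Sum.inr) := rfl
    rw [this, hr, hc, Fin.succAbove_zero, Fin.succAbove_zero]
    exact hj'
  have hb (a b : Fin 2) : |(M.submatrix r c).borderedMinor a b| ≤ τ := by
    have hinj (a : Fin 2) : Function.Injective (Sum.map (fun _ : Unit => a) (id : Fin n → Fin n)) :=
      (Function.injective_of_subsingleton _).sumMap Function.injective_id
    exact hM.abs_det_submatrix_le hτ (by simp [add_comm])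
      (r.injective.comp (hinj a)) (c.injective.comp (hinj b))
  have hprod (a b a' b' : Fin 2) :
      |(M.submatrix r c).borderedMinor a b * (M.submatrix r c).borderedMinor a' b'| ≤ τ ^ 2 := by
    rw [abs_mul, sq]
    exact mul_le_mul (hb a b) (hb a' b') (abs_nonneg _) ((abs_nonneg _).trans (hb a b))
  calc |M.det| = |(M.submatrix r c).det| := (Matrix.abs_det_submatrix_equiv_equiv r c M).symm
    _ ≤ |(M.submatrix r c).det| * |(M.submatrix r c).toBlocks₂₂.det| :=
      le_mul_of_one_le_right (abs_nonneg _) (Int.one_le_abs hD)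
    _ ≤ 2 * τ ^ 2 := by
      rw [← abs_mul, Matrix.det_mul_det_toBlocks₂₂_int _ hD, two_mul]
      exact (abs_sub _ _).trans (add_le_add (hprod 0 0 1 1) (hprod 0 1 1 0))
end

section
/- Let Δ ∈ ℕ and let S = {s ∈ ℤ : |s| ≤ Δ}. If M is an l×l integer matrix with l ≥ 2 that is a forbidden minor for S, then |det M| ≤ 2 * Δ^2. -/
open Polynomial Matrix

/-- The determinant divides every `2 × 2` minor of the adjugate. -/
theorem Matrix.det_dvd_adjugate_minor {n R : Type*} [Fintype n] [DecidableEq n] [CommRing R]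
    (M : Matrix n n R) (i k j l : n) :
    M.det ∣ M.adjugate i j * M.adjugate k l - M.adjugate i l * M.adjugate k j := by
  rcases eq_or_ne j l with rfl | hjl
  · simp
  set B := M.updateRow l (Pi.single k 1) with hB
  have hBdet : B.det = M.adjugate k l := (adjugate_apply M k l).symm
  have hrow : M.det • (Pi.single i 1 : n → R) =
      (∑ r, M.adjugate i r • B r) + M.adjugate i l • (M l - Pi.single k 1) := by
    have hM : M.det • (Pi.single i 1 : n → R) = ∑ r, M.adjugate i r • M r := by
      ext c
      have h := congrFun (congrFun (adjugate_mul M) i) c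
      rw [mul_apply] at h
      simp only [Finset.sum_apply, Pi.smul_apply, smul_eq_mul, h, smul_apply, one_apply,
        Pi.single_apply, eq_comm]
    have hBM : ∀ r, M.adjugate i r • M r = M.adjugate i r • B r +
        if r = l then M.adjugate i l • (M l - Pi.single k 1) else 0 := by
      intro r
      by_cases hr : r = l
      · subst hr
        have hBr : B r = Pi.single k 1 := updateRow_self
        rw [if_pos rfl, hBr, ← smul_add, add_sub_cancel]
      · have hBr : B r = M r := updateRow_ne hr
        rw [if_neg hr, hBr, add_zero]
    rw [hM, Finset.sum_congr rfl fun r _ => hBM r, Finset.sum_add_distrib]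
    simp
  have hzero : (B.updateRow j (Pi.single k 1)).det = 0 := by
    refine det_zero_of_row_eq hjl ?_
    rw [updateRow_self, updateRow_ne hjl.symm, hB, updateRow_self]
  have hswap : (B.updateRow j (M l)).det = -M.adjugate k j := by
    have h : B.updateRow j (M l) =
        (M.updateRow j (Pi.single k 1)).submatrix (Equiv.swap j l) id := by
      ext r c
      by_cases hrj : r = j
      · subst hrj
        simp [updateRow_ne hjl.symm]
      by_cases hrl : r = l
      · subst hrl
        simp [updateRow_ne hrj, hB]
      · simp [updateRow_ne hrj, updateRow_ne hrl, hB, Equiv.swap_apply_of_ne_of_ne hrj hrl]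
    rw [h, det_permute, Equiv.Perm.sign_swap hjl, adjugate_apply]
    simp
  refine ⟨(B.updateRow j (Pi.single i 1)).det, ?_⟩
  rw [← det_updateRow_smul, hrow, det_updateRow_add, det_updateRow_sum, det_updateRow_smul,
    sub_eq_add_neg (M l), det_updateRow_add, hswap, ← neg_one_smul R (Pi.single k 1),
    det_updateRow_smul, hzero, hBdet]
  simp only [smul_eq_mul]
  ring

/-- Two distinct rows of the adjugate of a nonsingular matrix have a nonzero `2 × 2` minor. -/
theorem Matrix.exists_adjugate_minor_ne_zero {n R : Type*} [Fintype n] [DecidableEq n]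
    [CommRing R] [IsDomain R] (M : Matrix n n R) (hM : M.det ≠ 0) {i k : n} (hik : i ≠ k) :
    ∃ j l, M.adjugate i j * M.adjugate k l - M.adjugate i l * M.adjugate k j ≠ 0 := by
  by_contra! h
  have hadj : ∀ r c, ∑ j, M.adjugate r j * M j c = if r = c then M.det else 0 := by
    intro r c
    rw [← mul_apply, adjugate_mul, smul_apply, one_apply]
    simp
  have hk : ∀ l, M.adjugate k l = 0 := by
    intro l
    have hsum : ∑ j, (M.adjugate i j * M.adjugate k l - M.adjugate i l * M.adjugate k j) * M j i
        = M.adjugate k l * M.det := by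
      calc _ = M.adjugate k l * ∑ j, M.adjugate i j * M j i
            - M.adjugate i l * ∑ j, M.adjugate k j * M j i := by
            rw [Finset.mul_sum, Finset.mul_sum, ← Finset.sum_sub_distrib]
            exact Finset.sum_congr rfl fun j _ => by ring
        _ = _ := by rw [hadj, hadj, if_pos rfl, if_neg hik.symm, mul_zero, sub_zero]
    simp only [h, zero_mul, Finset.sum_const_zero] at hsum
    exact (mul_eq_zero.mp hsum.symm).resolve_right hM
  apply hM
  simpa [hk] using (hadj k k).symm

/-- The entries of the adjugate are bounded as soon as all maximal proper minors are. -/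
theorem Matrix.abs_adjugate_le {n : ℕ} (M : Matrix (Fin (n + 1)) (Fin (n + 1)) ℤ) {b : ℤ}
    (h : ∀ f g : Fin n → Fin (n + 1), StrictMono f → StrictMono g →
      |(M.submatrix f g).det| ≤ b) (i j : Fin (n + 1)) : |M.adjugate i j| ≤ b := by
  rw [adjugate_fin_succ_eq_det_submatrix, abs_mul, abs_pow, abs_neg, abs_one, one_pow, one_mul]
  exact h _ _ (Fin.strictMono_succAbove j) (Fin.strictMono_succAbove i)

theorem stmt4 (Δ : ℕ) {l : ℕ} (hl : 2 ≤ l) (M : Matrix (Fin l) (Fin l) ℤ)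
    (hM : IsForbiddenMinor {s : ℤ | |s| ≤ (Δ : ℤ)} M) :
    |M.det| ≤ 2 * (Δ : ℤ) ^ 2 := by
  obtain ⟨n, rfl⟩ : ∃ n, l = n + 2 := ⟨l - 2, by omega⟩
  obtain ⟨-, hsub, hdet⟩ := hM
  have hdet0 : M.det ≠ 0 := by
    intro h
    simp [h] at hdet
  have hadj : ∀ i j, |M.adjugate i j| ≤ (Δ : ℤ) := M.abs_adjugate_le fun f g hf hg =>
    hsub f g hf hg (n + 1) (by omega) (by simp) id id strictMono_id strictMono_id
  obtain ⟨j, k, hjk⟩ := M.exists_adjugate_minor_ne_zero hdet0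
    (zero_ne_one : (0 : Fin (n + 2)) ≠ 1)
  have hmul : ∀ a b c d, |M.adjugate a b * M.adjugate c d| ≤ (Δ : ℤ) ^ 2 := by
    intro a b c d
    rw [abs_mul, sq]
    exact mul_le_mul (hadj a b) (hadj c d) (abs_nonneg _) (by positivity)
  calc |M.det| ≤ |M.adjugate 0 j * M.adjugate 1 k - M.adjugate 0 k * M.adjugate 1 j| :=
        Int.le_of_dvd (abs_pos.mpr hjk)
          ((abs_dvd_abs _ _).mpr (M.det_dvd_adjugate_minor 0 1 j k))
    _ ≤ |M.adjugate 0 j * M.adjugate 1 k| + |M.adjugate 0 k * M.adjugate 1 j| := abs_sub _ _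
    _ ≤ 2 * (Δ : ℤ) ^ 2 := by linarith [hmul 0 j 1 k, hmul 0 k 1 j]
end

section
/- Let S ⊆ ℤ be a finite set of integers and let τ ≥ 1 be an integer with |s| ≤ τ for all s ∈ S. Let M be an n×n integer matrix that is a forbidden minor for S, where n ≥ (Nat.clog 2 τ) + 1 (i.e. n ≥ ⌈log₂ τ⌉ + 1). Then |det M| ≤ 2 * ((Nat.clog 2 τ) + 1) * τ. -/
open Polynomial Matrix

/-- Jacobi's complementary minor identity for block matrices with `N * A = c • 1`. -/
lemma Matrix.det_mul_det_toBlocks₁₁_of_mul_eq_smul_one {R m l : Type*} [CommRing R]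
    [Fintype m] [DecidableEq m] [Fintype l] [DecidableEq l]
    {N A : Matrix (m ⊕ l) (m ⊕ l) R} {c : R} (h : N * A = c • 1) :
    N.det * A.toBlocks₁₁.det = c ^ Fintype.card m * N.toBlocks₂₂.det := by
  have h' : fromBlocks N.toBlocks₁₁ N.toBlocks₁₂ N.toBlocks₂₁ N.toBlocks₂₂ *
      fromBlocks A.toBlocks₁₁ A.toBlocks₁₂ A.toBlocks₂₁ A.toBlocks₂₂ = c • 1 := by
    rwa [fromBlocks_toBlocks, fromBlocks_toBlocks]
  rw [fromBlocks_multiply, ← fromBlocks_one, fromBlocks_smul, fromBlocks_inj] at h'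
  obtain ⟨h₁, -, h₂, -⟩ := h'
  have key : N * fromBlocks A.toBlocks₁₁ 0 A.toBlocks₂₁ 1 =
      fromBlocks (c • 1) N.toBlocks₁₂ 0 N.toBlocks₂₂ := by
    conv_lhs => rw [← fromBlocks_toBlocks N]
    rw [fromBlocks_multiply, h₁, h₂]
    simp
  have hdet := congrArg det key
  rw [det_mul, det_fromBlocks_zero₁₂, det_fromBlocks_zero₂₁, det_one, mul_one, det_smul,
    det_one, mul_one] at hdet
  exact hdet

/-- A square matrix with nonzero determinant has nonzero minors of every smaller size. -/
lemma Matrix.exists_submatrix_det_ne_zero_of_det_ne_zero {R : Type*} [CommRing R] {k : ℕ} :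
    ∀ {j : ℕ} (M : Matrix (Fin (k + j)) (Fin (k + j)) R), M.det ≠ 0 →
      ∃ f g : Fin k → Fin (k + j), Function.Injective f ∧ Function.Injective g ∧
        (M.submatrix f g).det ≠ 0
  | 0, M, hM => ⟨id, id, Function.injective_id, Function.injective_id, hM⟩
  | j + 1, M, hM => by
    have hex : ∃ i : Fin (k + j + 1),
        (M.submatrix (Fin.succAbove 0) (Fin.succAbove i)).det ≠ 0 := by
      by_contra! h
      refine hM ?_
      rw [det_succ_row_zero (n := k + j) M]
      exact Finset.sum_eq_zero fun i _ => by
        rw [← Fin.succAbove_zero, h i, mul_zero]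
    obtain ⟨i, hi⟩ := hex
    obtain ⟨f, g, hf, hg, hfg⟩ := exists_submatrix_det_ne_zero_of_det_ne_zero _ hi
    exact ⟨_, _, Fin.succAbove_right_injective.comp hf, Fin.succAbove_right_injective.comp hg,
      by simpa only [submatrix_submatrix] using hfg⟩

/-- An injection `Fin k → Fin (k + j)` extends to an equivalence from `Fin j ⊕ Fin k`. -/
lemma Fin.exists_sum_equiv_comp_inr_eq {k j : ℕ} {f : Fin k → Fin (k + j)}
    (hf : Function.Injective f) :
    ∃ e : Fin j ⊕ Fin k ≃ Fin (k + j), ∀ x, e (Sum.inr x) = f x := by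
  classical
  have hcard : Fintype.card {x // x ∉ Set.range f} = j := by
    rw [Fintype.card_subtype_compl, Fintype.card_fin]
    have : Fintype.card {x // x ∈ Set.range f} = k := by
      rw [← Fintype.card_congr (Equiv.ofInjective f hf), Fintype.card_fin]
    omega
  refine ⟨(Equiv.sumComm _ _).trans ((Equiv.sumCongr (Equiv.ofInjective f hf)
    (Fintype.equivFinOfCardEq hcard).symm).trans (Equiv.sumCompl (· ∈ Set.range f))), ?_⟩
  intro x
  simp

/-- If all entries of the adjugate of `M` are bounded by `τ`, then
`|det M| ^ j ≤ (j + 1)! * τ ^ (j + 1)` for every `j` smaller than the size of `M`. -/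
lemma Matrix.abs_det_pow_le_of_abs_adjugate_le {n j : ℕ} (hj : j + 1 ≤ n)
    (M : Matrix (Fin n) (Fin n) ℤ) (hM : M.det ≠ 0) {τ : ℤ}
    (hτ : ∀ a b, |M.adjugate a b| ≤ τ) :
    |M.det| ^ j ≤ (j + 1).factorial * τ ^ (j + 1) := by
  obtain ⟨k, rfl⟩ : ∃ k, n = k + (j + 1) := ⟨n - (j + 1), by omega⟩
  obtain ⟨f, g, hf, hg, hfg⟩ := M.exists_submatrix_det_ne_zero_of_det_ne_zero hM
  obtain ⟨e, he⟩ := Fin.exists_sum_equiv_comp_inr_eq hf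
  obtain ⟨e', he'⟩ := Fin.exists_sum_equiv_comp_inr_eq hg
  have hmul : M.submatrix e e' * M.adjugate.submatrix e' e = M.det • 1 := by
    rw [submatrix_mul_equiv, mul_adjugate, submatrix_smul, Pi.smul_apply, Pi.smul_apply,
      submatrix_one_equiv]
  have hjac := det_mul_det_toBlocks₁₁_of_mul_eq_smul_one hmul
  have hblock : (M.submatrix e e').toBlocks₂₂ = M.submatrix f g := by
    ext a b
    simp [toBlocks₂₂, he, he']
  rw [hblock, Fintype.card_fin] at hjac
  replace hjac := congrArg abs hjac
  rw [abs_mul, abs_mul, abs_det_submatrix_equiv_equiv, abs_pow, pow_succ', mul_assoc] at hjac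
  replace hjac := mul_left_cancel₀ (abs_ne_zero.mpr hM) hjac
  have hbound := det_le (A := (M.adjugate.submatrix e' e).toBlocks₁₁)
    (abv := AbsoluteValue.abs) (x := τ) fun a b => hτ _ _
  rw [AbsoluteValue.abs_apply, hjac, Fintype.card_fin, nsmul_eq_mul] at hbound
  exact (le_mul_of_one_le_right (by positivity) (Int.one_le_abs hfg)).trans hbound

/-- The adjugate of a forbidden minor for `S` is bounded entrywise by any bound on `S`. -/
lemma IsForbiddenMinor.abs_adjugate_le {S : Set ℤ} {τ : ℤ} (hτ : ∀ s ∈ S, |s| ≤ τ) {n : ℕ}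
    {M : Matrix (Fin n) (Fin n) ℤ} (hM : IsForbiddenMinor S M) (a b : Fin n) :
    |M.adjugate a b| ≤ τ := by
  obtain ⟨hn, hS, -⟩ := hM
  obtain ⟨m, rfl⟩ : ∃ m, n = m + 1 := ⟨n - 1, by omega⟩
  rw [adjugate_fin_succ_eq_det_submatrix, abs_mul, abs_pow, abs_neg, abs_one, one_pow, one_mul]
  exact hτ _ (hS b.succAbove a.succAbove (Fin.strictMono_succAbove b) (Fin.strictMono_succAbove a)
    m (by omega) (by simp) id id strictMono_id strictMono_id)

lemma Nat.factorial_succ_le_succ_pow (c : ℕ) : (c + 1).factorial ≤ (c + 1) ^ c := by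
  induction c with
  | zero => simp
  | succ c ih =>
    rw [Nat.factorial_succ, pow_succ']
    exact Nat.mul_le_mul_left _ (ih.trans (Nat.pow_le_pow_left (by omega) c))

theorem stmt5 (S : Set ℤ) (hS : S.Finite) (τ : ℕ) (hτ1 : 1 ≤ τ)
    (hτ : ∀ s ∈ S, |s| ≤ (τ : ℤ))
    {n : ℕ} (hn : Nat.clog 2 τ + 1 ≤ n) (M : Matrix (Fin n) (Fin n) ℤ)
    (hM : IsForbiddenMinor S M) :
    |M.det| ≤ 2 * ((Nat.clog 2 τ : ℤ) + 1) * (τ : ℤ) := by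
  by_cases hdet : M.det = 0
  · rw [hdet, abs_zero]
    positivity
  have hle : τ ≤ 2 ^ Nat.clog 2 τ := Nat.le_pow_clog one_lt_two τ
  have hadj := hM.abs_adjugate_le hτ
  generalize Nat.clog 2 τ = c at *
  rcases Nat.eq_zero_or_pos c with rfl | hc
  · obtain rfl : τ = 1 := by omega
    simpa using M.abs_det_pow_le_of_abs_adjugate_le (j := 1) hM.1 hdet hadj
  · refine le_of_pow_le_pow_left₀ hc.ne' (by positivity)
      ((M.abs_det_pow_le_of_abs_adjugate_le hn hdet hadj).trans ?_)
    have hnat : (c + 1).factorial * τ ^ (c + 1) ≤ (2 * (c + 1) * τ) ^ c :=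
      calc (c + 1).factorial * τ ^ (c + 1) = (c + 1).factorial * τ ^ c * τ := by ring
        _ ≤ (c + 1) ^ c * τ ^ c * 2 ^ c := by
          gcongr
          exact Nat.factorial_succ_le_succ_pow c
        _ = (2 * (c + 1) * τ) ^ c := by rw [mul_pow, mul_pow]; ring
    exact_mod_cast hnat
end

section
/- Let S ⊆ ℤ[X] be a finite set of polynomials, let a ∈ ℤ with a ∉ I(S), and let M be an m×n matrix over ℤ[X] all of whose entries lie in S. Then the integer matrix M(a) obtained by evaluating every entry of M at a is totally S(a)-modular if and only if M is totally S-modular, where S(a) = {s.eval a : s ∈ S}. -/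
open Polynomial Matrix

/-- Evaluating the entries of a matrix at `a` commutes with taking subdeterminants. -/
theorem det_submatrix_eval (a : ℤ) {m n k : ℕ} (M : Matrix (Fin m) (Fin n) (Polynomial ℤ))
    (f : Fin k → Fin m) (g : Fin k → Fin n) :
    ((Matrix.of fun i j => (M i j).eval a).submatrix f g).det =
      (M.submatrix f g).det.eval a := by
  rw [← Polynomial.coe_evalRingHom, RingHom.map_det]
  rfl

theorem stmt6 (S : Set (Polynomial ℤ)) (hS : S.Finite)
    (a : ℤ) (ha : a ∉ ISet S)
    {m n : ℕ} (M : Matrix (Fin m) (Fin n) (Polynomial ℤ))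
    (hentries : ∀ i j, M i j ∈ S) :
    IsTotallySModular ((fun s : Polynomial ℤ => s.eval a) '' S)
        (Matrix.of fun i j => (M i j).eval a) ↔
      IsTotallySModular S M := by
  constructor
  · intro h k
    induction k using Nat.strong_induction_on with
    | _ k ih =>
      intro hk hkmn f g hf hg
      obtain rfl | hk2 : k = 1 ∨ 2 ≤ k := by omega
      · simpa using hentries (f 0) (g 0)
      · by_contra hdet
        obtain ⟨s, hs, hsa⟩ := h k hk hkmn f g hf hg
        rw [det_submatrix_eval] at hsa
        refine ha ⟨s, hs, _, ⟨k, M.submatrix f g, ⟨hk2, ?_, hdet⟩, rfl⟩, hsa⟩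
        intro f' g' hf' hg' j hj hjk f'' g'' hf'' hg''
        exact ih j (by omega) hj (by omega) _ _
          (hf.comp (hf'.comp hf'')) (hg.comp (hg'.comp hg''))
  · intro h k hk hkmn f g hf hg
    exact ⟨_, h k hk hkmn f g hf hg, (det_submatrix_eval a M f g).symm⟩
end

section
/- Let S ⊆ ℤ[X] be a finite nonempty set of polynomials and let d be the maximum over s ∈ S of the natural degree natDegree s. Let T and R be m×n integer matrices and let M be the m×n matrix over ℤ[X] with entries M i j = C(T i j) + X * C(R i j). If M is totally S-modular, then the rank of R (i.e. the rank of the m×n matrix over ℚ obtained by casting the entries of R into ℚ) is at most d. -/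
open Polynomial Matrix

/-- Some strictly increasing selection of `A.rank` rows of `A` is linearly independent. -/
theorem Matrix.exists_strictMono_linearIndependent_row {K m n : Type*} [Field K]
    [Fintype m] [LinearOrder m] [Fintype n] (A : Matrix m n K) {r : ℕ} (hr : A.rank = r) :
    ∃ f : Fin r → m, StrictMono f ∧ LinearIndependent K (A.submatrix f id).row := by
  classical
  obtain ⟨κ, a, ha, hspan, hli⟩ := exists_linearIndependent' K A.row
  have : Fintype κ := Fintype.ofInjective a ha
  have hcard : (Finset.univ.image a).card = r := by
    rw [Finset.card_image_of_injective _ ha, Finset.card_univ, ← finrank_span_eq_card hli, hspan,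
      ← rank_eq_finrank_span_row, hr]
  have hmem (i : Fin r) : ∃ k, a k = (Finset.univ.image a).orderEmbOfFin hcard i := by
    obtain ⟨k, -, hk⟩ := Finset.mem_image.mp (Finset.orderEmbOfFin_mem (Finset.univ.image a) hcard i)
    exact ⟨k, hk⟩
  choose b hb using hmem
  refine ⟨(Finset.univ.image a).orderEmbOfFin hcard, OrderEmbedding.strictMono _, ?_⟩
  have hinj : Function.Injective b := fun i j hij =>
    ((Finset.univ.image a).orderEmbOfFin hcard).injective (by rw [← hb, ← hb, hij])
  have hrow : (A.submatrix ((Finset.univ.image a).orderEmbOfFin hcard) id).row =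
      (A.row ∘ a) ∘ b := by
    funext i j
    simp only [row_apply, submatrix_apply, id_eq, Function.comp_apply, hb]
  rw [hrow]
  exact hli.comp b hinj

/-- A matrix of rank `r` has a nonsingular `r × r` submatrix. -/
theorem Matrix.exists_strictMono_det_submatrix_ne_zero {K m n : Type*} [Field K]
    [Fintype m] [LinearOrder m] [Fintype n] [LinearOrder n] (A : Matrix m n K) {r : ℕ}
    (hr : A.rank = r) :
    ∃ (f : Fin r → m) (g : Fin r → n), StrictMono f ∧ StrictMono g ∧
      (A.submatrix f g).det ≠ 0 := by
  obtain ⟨f, hf, hfli⟩ := A.exists_strictMono_linearIndependent_row hr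
  have hrank : (A.submatrix f id)ᵀ.rank = r := by
    rw [rank_transpose, hfli.rank_matrix, Fintype.card_fin]
  obtain ⟨g, hg, hgli⟩ := (A.submatrix f id)ᵀ.exists_strictMono_linearIndependent_row hrank
  refine ⟨f, g, hf, hg, ?_⟩
  rw [← det_transpose]
  exact ((isUnit_iff_isUnit_det _).mp (linearIndependent_rows_iff_isUnit.mp hgli)).ne_zero

theorem stmt9 (S : Set (Polynomial ℤ)) (hS : S.Finite) (hne : S.Nonempty)
    (d : ℕ) (hd : IsGreatest ((fun s : Polynomial ℤ => s.natDegree) '' S) d)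
    {m n : ℕ} (T R : Matrix (Fin m) (Fin n) ℤ)
    (M : Matrix (Fin m) (Fin n) (Polynomial ℤ))
    (hM : ∀ i j, M i j = Polynomial.C (T i j) + Polynomial.X * Polynomial.C (R i j))
    (h : IsTotallySModular S M) :
    (R.map (fun x : ℤ => (x : ℚ))).rank ≤ d := by
  obtain ⟨r, hr⟩ : ∃ r, (R.map (fun x : ℤ => (x : ℚ))).rank = r := ⟨_, rfl⟩
  rw [hr]
  rcases Nat.eq_zero_or_pos r with rfl | hpos
  · exact Nat.zero_le d
  obtain ⟨f, g, hf, hg, hdet⟩ := exists_strictMono_det_submatrix_ne_zero _ hr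
  have hdetR : (R.submatrix f g).det ≠ 0 := by
    intro h0
    apply hdet
    have := Int.cast_det (R := ℚ) (R.submatrix f g)
    rw [h0, Int.cast_zero] at this
    exact this.symm
  have hrm : r ≤ m := by simpa using Fintype.card_le_of_injective f hf.injective
  have hrn : r ≤ n := by simpa using Fintype.card_le_of_injective g hg.injective
  have hmem := h r hpos (le_min hrm hrn) f g hf hg
  have hMsub : M.submatrix f g =
      (X : ℤ[X]) • (R.submatrix f g).map C + (T.submatrix f g).map C := by
    ext1 i j
    simp [hM, add_comm]
  have hcoeff : (M.submatrix f g).det.coeff r ≠ 0 := by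
    have := coeff_det_X_add_C_card (R.submatrix f g) (T.submatrix f g)
    rw [Fintype.card_fin] at this
    rwa [hMsub, this]
  exact (le_natDegree_of_ne_zero hcoeff).trans (hd.2 ⟨_, hmem, rfl⟩)
end

section
/- Let T be an n×n integer matrix and u, v ∈ ℤ^n integer vectors, and let M be the n×n matrix over ℤ[X] with entries M i j = C(T i j) + X * C(u i * v j). Then det M = C(det T − det (T − u ⬝ vᵀ)) * X + C(det T), where u ⬝ vᵀ denotes the n×n integer matrix with (i,j) entry u i * v j. -/
open Polynomial Matrix

/-- The determinant of `A - u vᵀ` as that of a bordered matrix, whose last column is `(u, 1)`. -/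
theorem det_sub_vecMulVec_eq_det_updateCol {m R : Type*} [Fintype m] [DecidableEq m] [CommRing R]
    (A : Matrix m m R) (u v : m → R) :
    (A - vecMulVec u v).det =
      ((fromBlocks A 0 (replicateRow Unit v) 1).updateCol (Sum.inr ()) (Sum.elim u 1)).det := by
  rw [vecMulVec_eq Unit, ← det_fromBlocks_one₂₂]
  congr 1
  ext (i | i) (j | j) <;> simp

/-- The determinant is affine along a rank-one direction. -/
theorem det_sub_vecMulVec_smul {m R : Type*} [Fintype m] [DecidableEq m] [CommRing R]
    (A : Matrix m m R) (u v : m → R) (x : R) :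
    (A - vecMulVec (x • u) v).det = x * (A - vecMulVec u v).det + (1 - x) * A.det := by
  have hA : A.det = (A - vecMulVec 0 v).det := by simp
  have hcol : (Sum.elim (x • u) 1 : m ⊕ Unit → R) =
      x • Sum.elim u 1 + (1 - x) • Sum.elim (0 : m → R) (1 : Unit → R) := by
    ext (i | i) <;> simp
  rw [hA]
  simp only [det_sub_vecMulVec_eq_det_updateCol]
  rw [hcol, det_updateCol_add, det_updateCol_smul, det_updateCol_smul]

theorem stmt10 {n : ℕ} (T : Matrix (Fin n) (Fin n) ℤ) (u v : Fin n → ℤ)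
    (M : Matrix (Fin n) (Fin n) (Polynomial ℤ))
    (hM : ∀ i j, M i j = Polynomial.C (T i j) + Polynomial.X * Polynomial.C (u i * v j)) :
    M.det =
      Polynomial.C (T.det - (T - Matrix.of fun i j => u i * v j).det) * Polynomial.X +
        Polynomial.C T.det := by
  have hM' : M = C.mapMatrix T - vecMulVec ((-X : ℤ[X]) • (C ∘ u)) (C ∘ v) := by
    ext1 i j
    simp [hM, vecMulVec_apply]
  have hTuv : C.mapMatrix T - vecMulVec (C ∘ u) (C ∘ v) =
      C.mapMatrix (T - Matrix.of fun i j => u i * v j) := by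
    ext1 i j
    simp [vecMulVec_apply]
  rw [hM', det_sub_vecMulVec_smul, hTuv, ← RingHom.map_det, ← RingHom.map_det, C_sub]
  ring
end

section
/- Let S = {0, X, −X, X+1, −(X+1), 2*X+1, −(2*X+1)} ⊆ ℤ[X]. If n ≥ 3 and M is an n×n matrix over ℤ[X] that is a forbidden minor for S, then det M lies in the set {1, 2*X, 2*X+2, 3*X+1, 3*X+2, 4*X+2} ∪ {−1, −2*X, −(2*X+2), −(3*X+1), −(3*X+2), −(4*X+2)}. -/
open Polynomial Matrix

/-- Coefficient pairs `(leading, constant)` of the allowed subdeterminants. -/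
def modularCoeffs : List (ℤ × ℤ) :=
  [(0, 0), (1, 0), (-1, 0), (1, 1), (-1, -1), (2, 1), (-2, -1)]

/-- Coefficient pairs `(leading, constant)` of the determinants of forbidden minors. -/
def forbiddenCoeffs : List (ℤ × ℤ) :=
  [(0, -1), (-2, 0), (-2, -2), (-3, -1), (-3, -2), (-4, -2),
    (0, 1), (2, 0), (2, 2), (3, 1), (3, 2), (4, 2)]

theorem mem_modular_iff_exists_coeffs (p : Polynomial ℤ) :
    p ∈ ({0, X, -X, X + 1, -(X + 1), 2 * X + 1, -(2 * X + 1)} : Set (Polynomial ℤ)) ↔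
      ∃ u ∈ modularCoeffs, p = C u.1 * X + C u.2 := by
  simp [modularCoeffs, add_comm]

theorem mem_forbidden_iff_exists_coeffs (p : Polynomial ℤ) :
    p ∈ ({1, 2 * X, 2 * X + 2, 3 * X + 1, 3 * X + 2, 4 * X + 2} ∪
        {-1, -(2 * X), -(2 * X + 2), -(3 * X + 1), -(3 * X + 2), -(4 * X + 2)} :
        Set (Polynomial ℤ)) ↔
      ∃ u ∈ forbiddenCoeffs, p = C u.1 * X + C u.2 := by
  simp [forbiddenCoeffs, add_comm]

/-- The quotient `(a * d - b * c) / e` of linear polynomials, when exact and linear, has its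
coefficients in one of the two lists. -/
theorem quotient_coeffs_mem :
    ∀ a ∈ modularCoeffs, ∀ b ∈ modularCoeffs, ∀ c ∈ modularCoeffs, ∀ d ∈ modularCoeffs,
    ∀ e ∈ modularCoeffs, e.1 ≠ 0 →
      (a.1 * d.1 - b.1 * c.1) / e.1 * e.2 +
        (a.1 * d.2 + a.2 * d.1 - (b.1 * c.2 + b.2 * c.1) -
          (a.1 * d.1 - b.1 * c.1) / e.1 * e.2) / e.1 * e.1 =
        a.1 * d.2 + a.2 * d.1 - (b.1 * c.2 + b.2 * c.1) →
      (a.1 * d.2 + a.2 * d.1 - (b.1 * c.2 + b.2 * c.1) -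
          (a.1 * d.1 - b.1 * c.1) / e.1 * e.2) / e.1 * e.2 = a.2 * d.2 - b.2 * c.2 →
      ((a.1 * d.1 - b.1 * c.1) / e.1 * e.1 = a.1 * d.1 - b.1 * c.1) →
      ((a.1 * d.1 - b.1 * c.1) / e.1,
        (a.1 * d.2 + a.2 * d.1 - (b.1 * c.2 + b.2 * c.1) -
          (a.1 * d.1 - b.1 * c.1) / e.1 * e.2) / e.1) ∈ modularCoeffs ++ forbiddenCoeffs := by
  decide +kernel

theorem fst_ne_zero_of_mem_modularCoeffs :
    ∀ e ∈ modularCoeffs, e ≠ (0, 0) → e.1 ≠ 0 := by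
  decide

theorem mem_forbidden_of_mul_eq {a b c d e D : Polynomial ℤ} {S : Set (Polynomial ℤ)}
    (hS : S = {0, X, -X, X + 1, -(X + 1), 2 * X + 1, -(2 * X + 1)})
    (ha : a ∈ S) (hb : b ∈ S) (hc : c ∈ S) (hd : d ∈ S) (he : e ∈ S) (he0 : e ≠ 0)
    (hD : D ∉ S) (h : D * e = a * d - b * c) :
    D ∈ ({1, 2 * X, 2 * X + 2, 3 * X + 1, 3 * X + 2, 4 * X + 2} ∪
      {-1, -(2 * X), -(2 * X + 2), -(3 * X + 1), -(3 * X + 2), -(4 * X + 2)} :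
        Set (Polynomial ℤ)) := by
  subst hS
  rw [mem_modular_iff_exists_coeffs] at ha hb hc hd he hD
  obtain ⟨a, ha, rfl⟩ := ha
  obtain ⟨b, hb, rfl⟩ := hb
  obtain ⟨c, hc, rfl⟩ := hc
  obtain ⟨d, hd, rfl⟩ := hd
  obtain ⟨e, he, rfl⟩ := he
  have he1 : e.1 ≠ 0 := by
    refine fst_ne_zero_of_mem_modularCoeffs e he ?_
    rintro rfl
    simp at he0
  have hD0 : D ≠ 0 := by
    rintro rfl
    exact hD ⟨(0, 0), by simp [modularCoeffs], by simp⟩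
  have hdeg : D.natDegree ≤ 1 := by
    have h1 := natDegree_mul hD0 he0
    rw [h, natDegree_linear he1] at h1
    have h2 : ((C a.1 * X + C a.2) * (C d.1 * X + C d.2) -
        (C b.1 * X + C b.2) * (C c.1 * X + C c.2) : Polynomial ℤ).natDegree ≤ 2 := by
      compute_degree
    omega
  obtain ⟨x, y, rfl⟩ : ∃ x y : ℤ, D = C x * X + C y :=
    ⟨_, _, eq_X_add_C_of_natDegree_le_one hdeg⟩
  have key : C (x * e.1) * X ^ 2 + C (x * e.2 + y * e.1) * X + C (y * e.2) =
      C (a.1 * d.1 - b.1 * c.1) * X ^ 2 +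
        C (a.1 * d.2 + a.2 * d.1 - (b.1 * c.2 + b.2 * c.1)) * X +
        C (a.2 * d.2 - b.2 * c.2) := by
    simp only [map_add, map_sub, map_mul]
    linear_combination h
  have h2 := congrArg (coeff · 2) key
  have h1 := congrArg (coeff · 1) key
  have h0 := congrArg (coeff · 0) key
  simp only [coeff_add, coeff_C_mul, coeff_X_pow, coeff_X, coeff_C] at h2 h1 h0
  norm_num at h2 h1 h0
  have hx : x = (a.1 * d.1 - b.1 * c.1) / e.1 := by
    rw [← h2, Int.mul_ediv_cancel _ he1]
  have hy : y = (a.1 * d.2 + a.2 * d.1 - (b.1 * c.2 + b.2 * c.1) -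
      x * e.2) / e.1 := by
    rw [← h1, add_sub_cancel_left, Int.mul_ediv_cancel _ he1]
  have hmem := quotient_coeffs_mem a ha b hb c hc d hd e he he1
  rw [← hx, ← hy] at hmem
  rcases List.mem_append.1 (hmem h1 h0 h2) with hm | hm
  · exact absurd ⟨_, hm, rfl⟩ hD
  · exact (mem_forbidden_iff_exists_coeffs _).2 ⟨_, hm, rfl⟩

section Jacobi

variable {R : Type*} [CommRing R]

theorem Matrix.det_one_updateRow_updateRow {ι : Type*} [Fintype ι] [DecidableEq ι] {i k : ι}
    (hik : i ≠ k) (u v : ι → R) :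
    (((1 : Matrix ι ι R).updateRow i u).updateRow k v).det = u i * v k - u k * v i := by
  have h : ((1 : Matrix ι ι R).updateRow i u).updateRow k v =
      1 + (Matrix.of ![Pi.single i (1 : R), Pi.single k 1])ᵀ *
        Matrix.of ![u - Pi.single i 1, v - Pi.single k 1] := by
    ext p q
    simp only [Matrix.updateRow_apply, Matrix.add_apply, Matrix.mul_apply, Fin.sum_univ_two,
      Matrix.one_apply, Matrix.transpose_apply, Matrix.of_apply]
    by_cases hp : p = k
    · subst hp
      simp [hik.symm, Pi.single_apply, eq_comm]
    · by_cases hp' : p = i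
      · subst hp'
        simp [hp, Pi.single_apply, eq_comm]
      · simp [hp, hp', Pi.single_apply]
  rw [h, Matrix.det_one_add_mul_comm, Matrix.det_fin_two]
  simp [Matrix.vecMul, dotProduct, Pi.single_apply, hik, hik.symm]

/-- Jacobi's identity for `2 × 2` minors of the adjugate. -/
theorem Matrix.det_mul_det_updateRow_updateRow [IsDomain R] {ι : Type*} [Fintype ι]
    [DecidableEq ι] (M : Matrix ι ι R) (hM : M.det ≠ 0) {i k : ι} (hik : i ≠ k) (j l : ι) :
    M.det * ((M.updateRow i (Pi.single j 1)).updateRow k (Pi.single l 1)).det =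
      M.adjugate j i * M.adjugate l k - M.adjugate j k * M.adjugate l i := by
  have h : (((1 : Matrix ι ι R).updateRow i (M.adjugate j)).updateRow k (M.adjugate l)) * M =
      (M.updateRow i (M.det • Pi.single j 1)).updateRow k (M.det • Pi.single l 1) := by
    have hadj (r : ι) : M.adjugate r ᵥ* M = M.det • Pi.single r 1 := by
      ext q
      have := congrFun (congrFun M.adjugate_mul r) q
      rw [Matrix.mul_apply] at this
      simpa [Matrix.vecMul, dotProduct, Matrix.one_apply, Pi.single_apply, eq_comm] using this
    simp [Matrix.updateRow_mul, hadj]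
  have hdet := congrArg Matrix.det h
  rw [Matrix.det_mul, Matrix.det_one_updateRow_updateRow hik, Matrix.det_updateRow_smul,
    Matrix.updateRow_comm _ hik, Matrix.det_updateRow_smul, Matrix.updateRow_comm _ hik.symm]
    at hdet
  apply mul_right_cancel₀ hM
  linear_combination -hdet

theorem Matrix.exists_det_submatrix_succAbove_ne_zero_s13 {m : ℕ}
    {M : Matrix (Fin (m + 1)) (Fin (m + 1)) R} (hM : M.det ≠ 0) :
    ∃ k l : Fin (m + 1), (M.submatrix k.succAbove l.succAbove).det ≠ 0 := by
  by_contra! h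
  rw [Matrix.det_succ_row M 0] at hM
  exact hM (Finset.sum_eq_zero fun j _ => by rw [h, mul_zero])

theorem Matrix.det_updateRow_single {m : ℕ} (M : Matrix (Fin (m + 1)) (Fin (m + 1)) R)
    (k l : Fin (m + 1)) :
    (M.updateRow k (Pi.single l 1)).det =
      (-1) ^ (k + l : ℕ) * (M.submatrix k.succAbove l.succAbove).det := by
  rw [← Matrix.adjugate_apply, Matrix.adjugate_fin_succ_eq_det_submatrix]

theorem Matrix.submatrix_updateRow_single_succAbove {m : ℕ}
    (M : Matrix (Fin (m + 2)) (Fin (m + 2)) R) (k l : Fin (m + 2)) (i j : Fin (m + 1)) :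
    (M.updateRow (k.succAbove i) (Pi.single (l.succAbove j) 1)).submatrix
        k.succAbove l.succAbove =
      (M.submatrix k.succAbove l.succAbove).updateRow i (Pi.single j 1) := by
  ext p q
  simp [Matrix.updateRow_apply, Pi.single_apply]

end Jacobi

theorem stmt13 {n : ℕ} (hn : 3 ≤ n) (M : Matrix (Fin n) (Fin n) (Polynomial ℤ))
    (hM : IsForbiddenMinor
      ({0, X, -X, X + 1, -(X + 1), 2 * X + 1, -(2 * X + 1)} : Set (Polynomial ℤ)) M) :
    M.det ∈ ({1, 2 * X, 2 * X + 2, 3 * X + 1, 3 * X + 2, 4 * X + 2} ∪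
      {-1, -(2 * X), -(2 * X + 2), -(3 * X + 1), -(3 * X + 2), -(4 * X + 2)} :
        Set (Polynomial ℤ)) := by
  obtain ⟨m, rfl⟩ : ∃ m, n = m + 2 := ⟨n - 2, by omega⟩
  obtain ⟨-, hsub, hdet⟩ := hM
  set S : Set (Polynomial ℤ) :=
    {0, X, -X, X + 1, -(X + 1), 2 * X + 1, -(2 * X + 1)} with hS
  have hneg {p : Polynomial ℤ} (hp : p ∈ S) (t : ℕ) : (-1) ^ t * p ∈ S := by
    rcases neg_one_pow_eq_or (Polynomial ℤ) t with h | h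
    · simpa [h] using hp
    · rw [h, neg_one_mul]
      simp only [hS, Set.mem_insert_iff, Set.mem_singleton_iff] at hp ⊢
      rcases hp with rfl | rfl | rfl | rfl | rfl | rfl | rfl <;> simp
  have hM0 : M.det ≠ 0 := fun h => hdet (by simp [h, hS])
  have hadj (p q : Fin (m + 2)) : M.adjugate p q ∈ S := by
    rw [Matrix.adjugate_fin_succ_eq_det_submatrix]
    exact hneg (hsub _ _ (Fin.strictMono_succAbove q) (Fin.strictMono_succAbove p) (m + 1)
      (by omega) (by simp) id id strictMono_id strictMono_id) _
  obtain ⟨k, l, hkl⟩ := Matrix.exists_det_submatrix_succAbove_ne_zero_s13 hM0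
  obtain ⟨i, j, hij⟩ := Matrix.exists_det_submatrix_succAbove_ne_zero_s13 hkl
  have hmin := hsub _ _ (Fin.strictMono_succAbove k) (Fin.strictMono_succAbove l) m
    (by omega) (by simp) _ _ (Fin.strictMono_succAbove i) (Fin.strictMono_succAbove j)
  have hjac := M.det_mul_det_updateRow_updateRow hM0 (Fin.succAbove_ne k i) (l.succAbove j) l
  rw [Matrix.det_updateRow_single, Matrix.submatrix_updateRow_single_succAbove,
    Matrix.det_updateRow_single] at hjac
  exact mem_forbidden_of_mul_eq hS (hadj _ _) (hadj _ _) (hadj _ _) (hadj _ _)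
    (hneg (hneg hmin _) _) (by simpa using hij) hdet hjac
end

section
/- Let S = {0, 1, −1, X, −X, X+1, −(X+1), 2*X+1, −(2*X+1)} ⊆ ℤ[X]. Let T be an m×n integer matrix, u ∈ ℤ^m and v ∈ ℤ^n integer vectors, and let M be the m×n matrix over ℤ[X] with entries M i j = C(T i j) + X * C(u i * v j). Then M is totally S-modular if and only if both T and T − u ⬝ vᵀ are totally unimodular, where u ⬝ vᵀ is the m×n integer matrix with (i,j) entry u i * v j. -/
open Polynomial Matrix

/-- The determinant of a rank-one perturbation is affine in the perturbation parameter. -/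
theorem Matrix.det_add_smul_vecMulVec {R ι : Type*} [CommRing R] [Fintype ι] [DecidableEq ι]
    (A : Matrix ι ι R) (u v : ι → R) (x : R) :
    (A + x • vecMulVec u v).det =
      A.det + x * (fromBlocks A (replicateCol Unit (-u)) (replicateRow Unit v) 0).det := by
  have hblock : (A + x • vecMulVec u v).det =
      (fromBlocks A (replicateCol Unit (-(x • u))) (replicateRow Unit v) 1).det := by
    rw [det_fromBlocks_one₂₂]
    congr 1
    ext i j
    simp [mul_apply, vecMulVec_apply, mul_assoc]
  have hcol (w : ι → R) (c : R) :
      fromBlocks A (replicateCol Unit w) (replicateRow Unit v) (of fun _ _ => c) =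
        (fromBlocks A (replicateCol Unit 0) (replicateRow Unit v) 1).updateCol (Sum.inr ())
          (Sum.elim w fun _ => c) := by
    ext (i | i) (j | j) <;> simp
  have hone : (1 : Matrix Unit Unit R) = of fun _ _ => 1 := by
    ext; simp
  have hzero : (0 : Matrix Unit Unit R) = of fun _ _ => 0 := rfl
  have hsplit : (Sum.elim (-(x • u)) fun _ => 1 : ι ⊕ Unit → R) =
      (Sum.elim (0 : ι → R) fun _ => 1) + x • Sum.elim (-u) fun _ => 0 := by
    ext (i | i) <;> simp
  rw [hblock, hone, hcol, hsplit, det_updateCol_add, det_updateCol_smul, ← hcol, ← hcol, ← hone,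
    ← hzero, det_fromBlocks_one₂₂]
  congr 2
  ext i j
  simp

/-- Over `ℤ[X]`, a rank-one perturbation with parameter `X` of an integer matrix has determinant
`a + b X`, where `a` and `a - b` are the determinants at `X = 0` and `X = -1`. -/
theorem exists_det_eq_C_add_X_mul_C {ι : Type*} [Fintype ι] [DecidableEq ι]
    (T : Matrix ι ι ℤ) (u v : ι → ℤ) (M : Matrix ι ι ℤ[X])
    (hM : ∀ i j, M i j = C (T i j) + X * C (u i * v j)) :
    ∃ b : ℤ, M.det = C T.det + X * C b ∧ (T - of fun i j => u i * v j).det = T.det - b := by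
  have hdet : ∃ b : ℤ, M.det = C T.det + X * C b := by
    refine ⟨(fromBlocks T (replicateCol Unit (-u)) (replicateRow Unit v) 0).det, ?_⟩
    have hsum : M = C.mapMatrix T + (X : ℤ[X]) • vecMulVec (fun i => C (u i)) fun j => C (v j) := by
      ext1 i j
      simp [hM, vecMulVec_apply]
    rw [hsum, det_add_smul_vecMulVec, RingHom.map_det, RingHom.map_det]
    congr 3
    ext1 (i | i) (j | j) <;> simp
  obtain ⟨b, hb⟩ := hdet
  refine ⟨b, hb, ?_⟩
  have heval : (evalRingHom (-1 : ℤ)).mapMatrix M = T - of fun i j => u i * v j := by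
    ext i j
    simp [hM]
    ring
  rw [← heval, ← RingHom.map_det, hb]
  simp
  ring

theorem C_add_X_mul_C_mem_iff (a b : ℤ) :
    C a + X * C b ∈
        ({0, 1, -1, X, -X, X + 1, -(X + 1), 2 * X + 1, -(2 * X + 1)} : Set ℤ[X]) ↔
      a ∈ ({-1, 0, 1} : Set ℤ) ∧ a - b ∈ ({-1, 0, 1} : Set ℤ) := by
  simp only [Set.mem_insert_iff, Set.mem_singleton_iff]
  constructor
  · intro h
    have heval (p : ℤ[X]) (hp : C a + X * C b = p) : a = p.eval 0 ∧ a - b = p.eval (-1) := by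
      subst hp
      simp [sub_eq_add_neg]
    rcases h with h | h | h | h | h | h | h | h | h <;>
      · obtain ⟨h₀, h₁⟩ := heval _ h
        simp at h₀ h₁
        omega
  · rintro ⟨ha, hb⟩
    have hcases : (a = 0 ∧ (b = 0 ∨ b = 1 ∨ b = -1)) ∨ (a = 1 ∧ (b = 0 ∨ b = 1 ∨ b = 2)) ∨
        (a = -1 ∧ (b = 0 ∨ b = -1 ∨ b = -2)) := by omega
    rcases hcases with ⟨rfl, rfl | rfl | rfl⟩ | ⟨rfl, rfl | rfl | rfl⟩ | ⟨rfl, rfl | rfl | rfl⟩ <;>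
      simp only [map_zero, map_one, map_neg, map_ofNat] <;> ring_nf <;> simp

theorem stmt14 {m n : ℕ} (T : Matrix (Fin m) (Fin n) ℤ) (u : Fin m → ℤ) (v : Fin n → ℤ)
    (M : Matrix (Fin m) (Fin n) (Polynomial ℤ))
    (hM : ∀ i j, M i j = Polynomial.C (T i j) + Polynomial.X * Polynomial.C (u i * v j)) :
    IsTotallySModular
        ({0, 1, -1, X, -X, X + 1, -(X + 1), 2 * X + 1, -(2 * X + 1)} : Set (Polynomial ℤ)) M ↔
      IsTotallySModular ({-1, 0, 1} : Set ℤ) T ∧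
        IsTotallySModular ({-1, 0, 1} : Set ℤ) (T - Matrix.of fun i j => u i * v j) := by
  have key (k : ℕ) (f : Fin k → Fin m) (g : Fin k → Fin n) :
      (M.submatrix f g).det ∈
          ({0, 1, -1, X, -X, X + 1, -(X + 1), 2 * X + 1, -(2 * X + 1)} : Set ℤ[X]) ↔
        (T.submatrix f g).det ∈ ({-1, 0, 1} : Set ℤ) ∧
          ((T - of fun i j => u i * v j).submatrix f g).det ∈ ({-1, 0, 1} : Set ℤ) := by
    obtain ⟨b, hb, hsub⟩ := exists_det_eq_C_add_X_mul_C (T.submatrix f g) (u ∘ f) (v ∘ g)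
      (M.submatrix f g) fun i j => hM (f i) (g j)
    have hT : (T - of fun i j => u i * v j).submatrix f g =
        T.submatrix f g - of fun i j => (u ∘ f) i * (v ∘ g) j := rfl
    rw [hT, hsub, hb, C_add_X_mul_C_mem_iff]
  constructor
  · intro h
    exact ⟨fun k h₁ h₂ f g hf hg => ((key k f g).1 (h k h₁ h₂ f g hf hg)).1,
      fun k h₁ h₂ f g hf hg => ((key k f g).1 (h k h₁ h₂ f g hf hg)).2⟩
  · rintro ⟨hT, hsub⟩ k h₁ h₂ f g hf hg
    exact (key k f g).2 ⟨hT k h₁ h₂ f g hf hg, hsub k h₁ h₂ f g hf hg⟩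
end

section
/- Let S = {0, X, −X, X+1, −(X+1), 2*X+1, −(2*X+1)} ⊆ ℤ[X] and n ≥ 2. Let M be an n×(n−1) matrix over ℤ[X] each of whose entries equals X or X+1, and suppose M is totally S-modular. Let N be the n×n matrix over ℤ[X] whose first n−1 columns are the columns of M and whose last column has every entry equal to 1. Then det N ∈ {−1, 0, 1}. -/
open Polynomial Matrix

namespace Matrix

section Adjugate

variable {ι : Type*} [Fintype ι] [DecidableEq ι]

/-- If some entry in row `k` of the adjugate is nonzero, any two kernel vectors are proportional
through their `k`-th coordinates. -/
theorem smul_eq_smul_of_mulVec_eq_zero_of_adjugate_ne_zero {R : Type*} [CommRing R] [IsDomain R]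
    {A : Matrix ι ι R} {k l : ι} (hkl : A.adjugate k l ≠ 0) {x y : ι → R}
    (hx : A *ᵥ x = 0) (hy : A *ᵥ y = 0) : x k • y = y k • x := by
  rw [adjugate_apply] at hkl
  refine sub_eq_zero.mp (eq_zero_of_mulVec_eq_zero hkl ?_)
  have hz : A *ᵥ (x k • y - y k • x) = 0 := by
    simp [mulVec_sub, mulVec_smul, hx, hy]
  ext i
  by_cases hi : i = l
  · subst hi
    simp [mulVec, updateRow_self, mul_comm]
  · simpa [mulVec, updateRow_ne hi] using congrFun hz i

theorem exists_adjugate_row_ne_zero {R : Type*} [CommRing R] {A : Matrix ι ι R} (hA : A.det ≠ 0)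
    (k : ι) : ∃ j, A.adjugate k j ≠ 0 := by
  by_contra! h
  have := congrFun (congrFun (adjugate_mul A) k) k
  simp [mul_apply, h] at this
  exact hA this.symm

theorem exists_adjugate_col_ne_zero {R : Type*} [CommRing R] {A : Matrix ι ι R} (hA : A.det ≠ 0)
    (k : ι) : ∃ i, A.adjugate i k ≠ 0 := by
  by_contra! h
  have := congrFun (congrFun (mul_adjugate A) k) k
  simp [mul_apply, h] at this
  exact hA this.symm

theorem _root_.Int.not_prime_dvd_of_abs_le_one {p : ℕ} (hp : p.Prime) {a : ℤ} (ha : |a| ≤ 1)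
    (h0 : a ≠ 0) : ¬ (p : ℤ) ∣ a := by
  intro h
  have := hp.two_le
  have := Int.le_of_dvd (abs_pos.mpr h0) ((dvd_abs _ _).mpr h)
  lia

/-- The `2 × 2` minors of an adjugate with entries in `{-1, 0, 1}` vanish modulo every prime
divisor of a nonzero determinant. -/
theorem prime_dvd_adjugate_minor {A : Matrix ι ι ℤ} (hA : A.det ≠ 0)
    (hadj : ∀ i j, |A.adjugate i j| ≤ 1) {p : ℕ} (hp : p.Prime) (hpA : (p : ℤ) ∣ A.det)
    (k i j j' : ι) :
    (p : ℤ) ∣ A.adjugate k j * A.adjugate i j' - A.adjugate k j' * A.adjugate i j := by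
  have := Fact.mk hp
  obtain ⟨l, hl⟩ := exists_adjugate_row_ne_zero hA k
  have hmap : (A.map (Int.castRingHom (ZMod p))).adjugate
      = A.adjugate.map (Int.castRingHom (ZMod p)) :=
    ((Int.castRingHom (ZMod p)).map_adjugate A).symm
  have hl' : (A.map (Int.castRingHom (ZMod p))).adjugate k l ≠ 0 := by
    rw [hmap]
    simpa [ZMod.intCast_zmod_eq_zero_iff_dvd] using
      Int.not_prime_dvd_of_abs_le_one hp (hadj k l) hl
  have hker : ∀ c, A.map (Int.castRingHom (ZMod p)) *ᵥ
      (fun i => ((A.adjugate i c : ℤ) : ZMod p)) = 0 := by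
    intro c
    ext r
    have h := congrFun (congrFun (mul_adjugate A) r) c
    have h2 := congrArg (Int.cast : ℤ → ZMod p) h
    have h3 : ((A.det : ℤ) : ZMod p) = 0 := (ZMod.intCast_zmod_eq_zero_iff_dvd _ _).mpr hpA
    simp [mul_apply, h3] at h2
    simpa [mulVec, dotProduct] using h2
  have := congrFun (smul_eq_smul_of_mulVec_eq_zero_of_adjugate_ne_zero hl' (hker j) (hker j')) i
  rw [← ZMod.intCast_zmod_eq_zero_iff_dvd]
  simpa [sub_eq_zero] using this

theorem exists_prime_dvd_det {A : Matrix ι ι ℤ} (hA : 2 ≤ |A.det|) :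
    ∃ p : ℕ, p.Prime ∧ (p : ℤ) ∣ A.det := by
  obtain ⟨p, hp, hpA⟩ := Nat.exists_prime_and_dvd (n := A.det.natAbs) (by
    rw [Int.abs_eq_natAbs] at hA; lia)
  exact ⟨p, hp, Int.natCast_dvd.mpr hpA⟩

theorem adjugate_ne_zero_of_abs_le_one {A : Matrix ι ι ℤ} (hA : 2 ≤ |A.det|)
    (hadj : ∀ i j, |A.adjugate i j| ≤ 1) (k j : ι) : A.adjugate k j ≠ 0 := by
  have h0 : A.det ≠ 0 := by rintro h; simp [h] at hA
  obtain ⟨p, hp, hpA⟩ := exists_prime_dvd_det hA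
  intro hkj
  obtain ⟨j', hj'⟩ := exists_adjugate_row_ne_zero h0 k
  obtain ⟨i, hi⟩ := exists_adjugate_col_ne_zero h0 j
  have h := prime_dvd_adjugate_minor h0 hadj hp hpA k i j j'
  rw [hkj, zero_mul, zero_sub, dvd_neg] at h
  refine Int.not_prime_dvd_of_abs_le_one hp ?_ (mul_ne_zero hj' hi) h
  rw [abs_mul]
  exact mul_le_one₀ (hadj _ _) (abs_nonneg _) (hadj _ _)

/-- A square integer matrix whose cofactors all lie in `{-1, 0, 1}` but whose determinant
does not has even determinant. -/
theorem even_det_of_abs_adjugate_le_one [Nontrivial ι] {A : Matrix ι ι ℤ} (hA : 2 ≤ |A.det|)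
    (hadj : ∀ i j, |A.adjugate i j| ≤ 1) : 2 ∣ A.det := by
  have h0 : A.det ≠ 0 := by rintro h; simp [h] at hA
  obtain ⟨p, hp, hpA⟩ := exists_prime_dvd_det hA
  rcases hp.two_le.eq_or_lt with rfl | hp3
  · exact_mod_cast hpA
  exfalso
  have hminor : ∀ k i j j',
      A.adjugate k j * A.adjugate i j' = A.adjugate k j' * A.adjugate i j := by
    intro k i j j'
    refine sub_eq_zero.mp
      (Int.eq_zero_of_abs_lt_dvd (prime_dvd_adjugate_minor h0 hadj hp hpA k i j j') ?_)
    have hmul : ∀ a b a' b', |A.adjugate a b * A.adjugate a' b'| ≤ 1 := fun a b a' b' => by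
      rw [abs_mul]
      exact mul_le_one₀ (hadj _ _) (abs_nonneg _) (hadj _ _)
    have := abs_sub (A.adjugate k j * A.adjugate i j') (A.adjugate k j' * A.adjugate i j)
    have := hmul k j i j'
    have := hmul k j' i j
    lia
  obtain ⟨j, j', hne⟩ := exists_pair_ne ι
  have hj := congrFun (congrFun (mul_adjugate A) j') j
  have hj' := congrFun (congrFun (mul_adjugate A) j') j'
  simp only [mul_apply, smul_apply, one_apply_eq, one_apply_ne hne.symm, smul_eq_mul, mul_one,
    mul_zero] at hj hj'
  have h : A.adjugate j j * A.det = A.adjugate j j' * 0 := by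
    rw [← hj, ← hj', Finset.mul_sum, Finset.mul_sum]
    refine Finset.sum_congr rfl fun i _ => ?_
    linear_combination A j' i * hminor j i j j'
  exact mul_ne_zero (adjugate_ne_zero_of_abs_le_one hA hadj j j) h0 (by simpa using h)

theorem even_row_sum_of_abs_adjugate_le_one [Nontrivial ι] {A : Matrix ι ι ℤ} (hA : 2 ≤ |A.det|)
    (hadj : ∀ i j, |A.adjugate i j| ≤ 1) (r : ι) : 2 ∣ ∑ i, A r i := by
  have hdet := even_det_of_abs_adjugate_le_one hA hadj
  have h := congrFun (congrFun (mul_adjugate A) r) r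
  simp only [mul_apply, smul_apply, one_apply_eq, smul_eq_mul, mul_one] at h
  have hsub : (2 : ℤ) ∣ ∑ i, A r i * (A.adjugate i r - 1) := by
    refine Finset.dvd_sum fun i _ => Dvd.dvd.mul_left ?_ _
    have h1 := adjugate_ne_zero_of_abs_le_one hA hadj i r
    have h2 := hadj i r
    rw [abs_le] at h2
    lia
  simp only [mul_sub, mul_one, Finset.sum_sub_distrib, h] at hsub
  lia

theorem even_col_sum_of_abs_adjugate_le_one [Nontrivial ι] {A : Matrix ι ι ℤ} (hA : 2 ≤ |A.det|)
    (hadj : ∀ i j, |A.adjugate i j| ≤ 1) (c : ι) : 2 ∣ ∑ i, A i c :=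
  even_row_sum_of_abs_adjugate_le_one (A := Aᵀ) (by rwa [det_transpose])
    (fun i j => by rw [← adjugate_transpose]; exact hadj j i) c

end Adjugate

theorem det_eq_of_forall_col_eq_add_const {ι R : Type*} [Fintype ι] [DecidableEq ι] [CommRing R]
    {A B : Matrix ι ι R} (v : ι → R) (k : ι) (hk : v k = 0)
    (h : ∀ i j, A i j = B i j + v j * B i k) : A.det = B.det := by
  rw [← det_transpose A, ← det_transpose B]
  exact det_eq_of_forall_row_eq_smul_add_const v k hk fun i j => h j i

theorem abs_det_eq_of_complement {ι : Type*} [Fintype ι] [DecidableEq ι] {A C : Matrix ι ι ℤ}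
    {c : ι} (hA : ∀ i, A i c = 1) (hC : ∀ i, C i c = 1)
    (hAC : ∀ i j, j ≠ c → C i j = 1 - A i j) : |C.det| = |A.det| := by
  have h : C.det = det (of fun i j => (if j = c then (1 : ℤ) else -1) * A i j) := by
    refine det_eq_of_forall_col_eq_add_const (fun j => if j = c then 0 else 1) c (by simp) ?_
    intro i j
    by_cases hj : j = c
    · simp [hj, hA, hC]
    · simp [hj, hA, hAC i j hj]
      ring
  rw [h, det_mul_row, abs_mul, Finset.abs_prod, Finset.prod_eq_one, one_mul]
  intro j _
  split_ifs <;> simp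

/-- If `A` has an all-ones column `c`, and the subdeterminants avoiding column `c`, both of `A` and
of its complement `1 - A`, all lie in `{-1, 0, 1}`, then so does the determinant of `A`. -/
theorem abs_det_le_one_of_complement {n : ℕ} {A C : Matrix (Fin n) (Fin n) ℤ} {c : Fin n}
    (hA : ∀ i, A i c = 1) (hC : ∀ i, C i c = 1) (hAC : ∀ i j, j ≠ c → C i j = 1 - A i j)
    (mA : ∀ k (f g : Fin k → Fin n), StrictMono f → StrictMono g → (∀ j, g j ≠ c) →
      |(A.submatrix f g).det| ≤ 1)
    (mC : ∀ k (f g : Fin k → Fin n), StrictMono f → StrictMono g → (∀ j, g j ≠ c) →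
      |(C.submatrix f g).det| ≤ 1) : |A.det| ≤ 1 := by
  induction n with
  | zero => exact c.elim0
  | succ n ih =>
    have adj : ∀ {A C : Matrix (Fin (n + 1)) (Fin (n + 1)) ℤ}, (∀ i, A i c = 1) →
        (∀ i, C i c = 1) → (∀ i j, j ≠ c → C i j = 1 - A i j) →
        (∀ k (f g : Fin k → Fin (n + 1)), StrictMono f → StrictMono g → (∀ j, g j ≠ c) →
          |(A.submatrix f g).det| ≤ 1) →
        (∀ k (f g : Fin k → Fin (n + 1)), StrictMono f → StrictMono g → (∀ j, g j ≠ c) →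
          |(C.submatrix f g).det| ≤ 1) → ∀ i j, |A.adjugate i j| ≤ 1 := by
      intro A C hA hC hAC mA mC i j
      rw [adjugate_fin_succ_eq_det_submatrix, abs_mul, abs_pow, abs_neg, abs_one, one_pow, one_mul]
      by_cases hi : i = c
      · subst hi
        exact mA n _ _ (Fin.strictMono_succAbove j) (Fin.strictMono_succAbove i)
          (Fin.succAbove_ne i)
      · obtain ⟨c', hc'⟩ := Fin.exists_succAbove_eq (Ne.symm hi)
        have hne : ∀ l, l ≠ c' → i.succAbove l ≠ c := fun l hl h =>
          hl (Fin.succAbove_right_injective (h.trans hc'.symm))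
        refine ih (C := C.submatrix j.succAbove i.succAbove) (c := c') (by simp [hc', hA])
          (by simp [hc', hC]) (fun r l hl => hAC _ _ (hne l hl)) ?_ ?_
        · intro k f g hf hg hgc
          exact mA k _ _ ((Fin.strictMono_succAbove j).comp hf)
            ((Fin.strictMono_succAbove i).comp hg) fun l => hne _ (hgc l)
        · intro k f g hf hg hgc
          exact mC k _ _ ((Fin.strictMono_succAbove j).comp hf)
            ((Fin.strictMono_succAbove i).comp hg) fun l => hne _ (hgc l)
    rcases n with _ | n
    · simp [det_unique, Subsingleton.elim (default : Fin 1) c, hA]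
    by_contra! hdet
    have hdetA : 2 ≤ |A.det| := hdet
    have hdetC : 2 ≤ |C.det| := by rwa [abs_det_eq_of_complement hA hC hAC]
    have adjA := adj hA hC hAC mA mC
    have adjC := adj hC hA (fun i j hj => by rw [hAC i j hj]; ring) mC mA
    have hcol := even_col_sum_of_abs_adjugate_le_one hdetA adjA c
    have hrowA := even_row_sum_of_abs_adjugate_le_one hdetA adjA c
    have hrowC := even_row_sum_of_abs_adjugate_le_one hdetC adjC c
    have hsum : ∑ j, C c j + ∑ j, A c j = n + 3 := by
      rw [← Finset.sum_add_distrib, ← Finset.add_sum_erase _ _ (Finset.mem_univ c),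
        Finset.sum_congr rfl fun j hj => show C c j + A c j = 1 by
          rw [hAC c j (Finset.ne_of_mem_erase hj)]; ring]
      simp [hA, hC]
      ring
    simp [hA] at hcol
    lia

end Matrix

theorem stmt16 {n : ℕ} (hn : 2 ≤ n)
    (M : Matrix (Fin n) (Fin (n - 1)) (Polynomial ℤ))
    (hent : ∀ i j, M i j = X ∨ M i j = X + 1)
    (hmod : IsTotallySModular
      ({0, X, -X, X + 1, -(X + 1), 2 * X + 1, -(2 * X + 1)} : Set (Polynomial ℤ)) M)
    (N : Matrix (Fin n) (Fin n) (Polynomial ℤ))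
    (hN : ∀ i j : Fin n,
      N i j = if h : (j : ℕ) < n - 1 then M i ⟨(j : ℕ), h⟩ else 1) :
    N.det ∈ ({-1, 0, 1} : Set (Polynomial ℤ)) := by
  obtain ⟨c, hc⟩ : ∃ c : Fin n, (c : ℕ) = n - 1 := ⟨⟨n - 1, by lia⟩, rfl⟩
  have hNc : ∀ i, N i c = 1 := fun i => by simp [hN, hc]
  have hlt : ∀ j : Fin n, j ≠ c → (j : ℕ) < n - 1 := fun j hj => by
    have := j.isLt
    have := Fin.val_ne_of_ne hj
    lia
  have hNent : ∀ i j, j ≠ c → N i j = X ∨ N i j = X + 1 := fun i j hj => by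
    rw [hN, dif_pos (hlt j hj)]
    exact hent _ _
  have hminor : ∀ k (f g : Fin k → Fin n), StrictMono f → StrictMono g → (∀ j, g j ≠ c) →
      |(N.submatrix f g).det.eval 0| ≤ 1 ∧ |(N.submatrix f g).det.eval (-1)| ≤ 1 := by
    intro k f g hf hg hgc
    rcases Nat.eq_zero_or_pos k with rfl | hk
    · simp
    let g' : Fin k → Fin (n - 1) := fun j => ⟨g j, hlt _ (hgc j)⟩
    have hg' : StrictMono g' := fun a b hab => hg hab
    have hkn : k ≤ n - 1 := by simpa using Fintype.card_le_of_injective g' hg'.injective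
    have hsub : N.submatrix f g = M.submatrix f g' := by
      ext1 i j
      simp [hN, hlt _ (hgc j), g']
    have h := hmod k hk (le_min (by lia) hkn) f g' hf hg'
    rw [← hsub] at h
    simp only [Set.mem_insert_iff, Set.mem_singleton_iff] at h
    rcases h with h | h | h | h | h | h | h <;> rw [h] <;> simp
  let A : Matrix (Fin n) (Fin n) ℤ := of fun i j => (N i j).eval 0
  let E : Matrix (Fin n) (Fin n) ℤ := of fun i j =>
    if j = c then 1 else -(N i j).eval (-1)
  have hdet : |A.det| ≤ 1 := by
    refine abs_det_le_one_of_complement (A := A) (C := E) (c := c) (by simp [A, hNc])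
      (by simp [E]) ?_ ?_ ?_
    · intro i j hj
      rcases hNent i j hj with h | h <;> simp [A, E, hj, h]
    · intro k f g hf hg hgc
      have : A.submatrix f g = (N.submatrix f g).map (evalRingHom 0) := by
        ext; simp [A]
      rw [this, ← RingHom.mapMatrix_apply, ← RingHom.map_det]
      exact (hminor k f g hf hg hgc).1
    · intro k f g hf hg hgc
      have : E.submatrix f g = -(N.submatrix f g).map (evalRingHom (-1)) := by
        ext; simp [E, hgc]
      rw [this, det_neg, ← RingHom.mapMatrix_apply, ← RingHom.map_det, abs_mul, abs_pow, abs_neg,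
        abs_one, one_pow, one_mul]
      exact (hminor k f g hf hg hgc).2
  have hNA : N.det = Polynomial.C A.det := by
    rw [RingHom.map_det]
    refine det_eq_of_forall_col_eq_add_const (fun j => if j = c then 0 else X) c (by simp) ?_
    intro i j
    by_cases hj : j = c
    · simp [hj, A, hNc]
    · rcases hNent i j hj with h | h <;> simp [hj, A, hNc, h, add_comm]
  rw [hNA]
  have : A.det = -1 ∨ A.det = 0 ∨ A.det = 1 := by
    rw [abs_le] at hdet
    lia
  rcases this with h | h | h <;> simp [h]
end

section
/- Let a ∈ ℤ with a ∉ {−2, −1, 0, 1}, let S(a) = {0, a, −a, a+1, −(a+1), 2*a+1, −(2*a+1)} ⊆ ℤ, and let n ≥ 2. Let M be an n×(n−1) integer matrix each of whose entries equals a or a+1, and suppose M is totally S(a)-modular. Let N be the n×n integer matrix whose first n−1 columns are the columns of M and whose last column has every entry equal to 1. Then det N ∈ {−1, 0, 1}. -/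
open Polynomial Matrix

theorem IsTotallySModular.submatrix {R : Type*} [CommRing R] {m n m' n' : ℕ} {S : Set R}
    {M : Matrix (Fin m) (Fin n) R} (h : IsTotallySModular S M)
    {f : Fin m' → Fin m} {g : Fin n' → Fin n} (hf : StrictMono f) (hg : StrictMono g) :
    IsTotallySModular S (M.submatrix f g) := by
  intro k hk hk' f' g' hf' hg'
  have hm : m' ≤ m := by simpa using Fintype.card_le_of_injective f hf.injective
  have hn : n' ≤ n := by simpa using Fintype.card_le_of_injective g hg.injective
  rw [Matrix.submatrix_submatrix]
  exact h k hk (hk'.trans (min_le_min hm hn)) _ _ (hf.comp hf') (hg.comp hg')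

theorem Matrix.adjugate_apply_eq_det_updateCol {ι R : Type*} [Fintype ι] [DecidableEq ι]
    [CommRing R] (A : Matrix ι ι R) (i j : ι) :
    A.adjugate i j = (A.updateCol i (Pi.single j 1)).det := by
  rw [← Matrix.cramer_apply, Matrix.cramer_eq_adjugate_mulVec, Matrix.mulVec_single_one,
    Matrix.col_apply]

theorem Matrix.sum_mul_adjugate_apply {ι R : Type*} [Fintype ι] [DecidableEq ι] [CommRing R]
    (N : Matrix ι ι R) (i j : ι) :
    ∑ k, N i k * N.adjugate k j = if i = j then N.det else 0 := by
  have := congrFun (congrFun N.mul_adjugate i) j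
  rw [Matrix.mul_apply] at this
  rw [this, Matrix.smul_apply, Matrix.one_apply]
  simp

/-- The `2 × 2` case of the Jacobi identity: a `2 × 2` minor of the adjugate is the determinant times
the determinant obtained by replacing two columns by standard basis vectors. -/
theorem Matrix.adjugate_mul_adjugate_sub {ι R : Type*} [Fintype ι] [DecidableEq ι] [CommRing R]
    (N : Matrix ι ι R) {j j' : ι} (hj : j ≠ j') (i i' : ι) :
    N.adjugate j i * N.adjugate j' i' - N.adjugate j i' * N.adjugate j' i =
      N.det * (N.updateCol j (Pi.single i 1)).adjugate j' i' := by
  set B := N.updateCol j (Pi.single i 1) with hB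
  have hcol : (N.det • Pi.single i' 1 : ι → R) = ∑ k, N.adjugate k i' • N.col k := by
    ext r
    simpa [Pi.single_apply, mul_comm, eq_comm] using (N.sum_mul_adjugate_apply r i').symm
  have hlin : N.det * B.adjugate j' i' = ∑ k, N.adjugate k i' * B.cramer (N.col k) j' := by
    rw [Matrix.adjugate_apply_eq_det_updateCol, ← Matrix.cramer_apply, ← smul_eq_mul,
      ← Pi.smul_apply, ← map_smul, hcol, map_sum]
    simp
  rw [hlin, Finset.sum_eq_add_of_mem j j' (Finset.mem_univ _) (Finset.mem_univ _) hj]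
  · have h1 : B.cramer (N.col j') j' = N.adjugate j i := by
      rw [Matrix.cramer_apply, Matrix.adjugate_apply_eq_det_updateCol N]
      congr 1
      ext r c
      simp only [hB, Matrix.updateCol_apply, Matrix.col_apply]
      grind
    have h2 : B.cramer (N.col j) j' = - N.adjugate j' i := by
      have hswap : B.updateCol j' (N.col j) =
          (N.updateCol j' (Pi.single i 1)).submatrix id (Equiv.swap j j') := by
        ext r c
        simp only [hB, Matrix.updateCol_apply, Matrix.col_apply, Matrix.submatrix_apply,
          Equiv.swap_apply_def, id_eq]
        grind
      rw [Matrix.cramer_apply, Matrix.adjugate_apply_eq_det_updateCol N, hswap,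
        Matrix.det_permute', Equiv.Perm.sign_swap hj]
      simp
    rw [h1, h2]; ring
  · intro k _ hk
    have : B.cramer (N.col k) j' = 0 := by
      rw [Matrix.cramer_apply]
      refine Matrix.det_zero_of_column_eq hk.2 fun r => ?_
      simp [hB, hk.1, hk.2]
    rw [this, mul_zero]

/-- The matrix `M` with a last column of ones appended. -/
def Matrix.snocOnes {m n : ℕ} (M : Matrix (Fin m) (Fin n) ℤ) : Matrix (Fin m) (Fin (n + 1)) ℤ :=
  Matrix.of fun i => Fin.snoc (α := fun _ => ℤ) (M i) 1

theorem Matrix.snocOnes_castSucc {m n : ℕ} (M : Matrix (Fin m) (Fin n) ℤ) (i : Fin m)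
    (j : Fin n) : M.snocOnes i j.castSucc = M i j := by
  simp [Matrix.snocOnes]

theorem Matrix.snocOnes_last {m n : ℕ} (M : Matrix (Fin m) (Fin n) ℤ) (i : Fin m) :
    M.snocOnes i (Fin.last n) = 1 := by
  simp [Matrix.snocOnes]

theorem Matrix.snocOnes_submatrix_castSucc_succAbove {m n p : ℕ}
    (M : Matrix (Fin m) (Fin (n + 1)) ℤ) (f : Fin p → Fin m) (j : Fin (n + 1)) :
    M.snocOnes.submatrix f j.castSucc.succAbove = (M.submatrix f j.succAbove).snocOnes := by
  ext r c
  induction c using Fin.lastCases with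
  | last =>
    simp [Matrix.snocOnes_last]
  | cast c => simp [Matrix.snocOnes_castSucc]

theorem Matrix.snocOnes_submatrix_last_succAbove {m n p : ℕ}
    (M : Matrix (Fin m) (Fin n) ℤ) (f : Fin p → Fin m) :
    M.snocOnes.submatrix f (Fin.last n).succAbove = M.submatrix f id := by
  ext r c
  simp [Matrix.snocOnes_castSucc]

/-- Replacing a column by a standard basis vector and passing to a cofactor gives, up to sign, a
minor with two rows and two columns deleted. -/
theorem Matrix.adjugate_updateCol_single_eq {n : ℕ} {R : Type*} [CommRing R]
    (N : Matrix (Fin (n + 2)) (Fin (n + 2)) R) (j' i' : Fin (n + 2)) (l r : Fin (n + 1)) :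
    (N.updateCol (j'.succAbove l) (Pi.single (i'.succAbove r) 1)).adjugate j' i' =
      (-1) ^ (i' + j' : ℕ) * ((-1) ^ (r + l : ℕ) *
        ((N.submatrix i'.succAbove j'.succAbove).submatrix r.succAbove l.succAbove).det) := by
  rw [Matrix.adjugate_fin_succ_eq_det_submatrix]
  congr 1
  rw [← Matrix.adjugate_fin_succ_eq_det_submatrix]
  rw [Matrix.adjugate_apply_eq_det_updateCol]
  congr 1
  ext p q
  simp [Matrix.updateCol_apply, Pi.single_apply]

/-- The admissible values of the subdeterminants. -/
def admissibleValues (a : ℤ) : Set ℤ :=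
  {0, a, -a, a + 1, -(a + 1), 2 * a + 1, -(2 * a + 1)}

theorem neg_one_pow_mul_mem {S : Set ℤ} (hS : ∀ x ∈ S, -x ∈ S) (k : ℕ) {x : ℤ} (hx : x ∈ S) :
    (-1) ^ k * x ∈ S := by
  rcases neg_one_pow_eq_or ℤ k with h | h <;> simp [h, hx, hS]

theorem neg_mem_admissibleValues {a : ℤ} : ∀ x ∈ admissibleValues a, -x ∈ admissibleValues a := by
  intro x hx
  simp only [admissibleValues, Set.mem_insert_iff, Set.mem_singleton_iff] at hx ⊢
  omega

theorem eq_or_eq_neg_of_mem_admissibleValues {a : ℤ} (ha : a ∉ ({-2, -1, 0, 1} : Set ℤ))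
    {x y d : ℤ} (hx : x ∈ admissibleValues a) (hy : y ∈ admissibleValues a)
    (hd : d ∈ admissibleValues a) (hxd : x - y = 2 * d) : x = y ∨ x = -y := by
  simp only [admissibleValues, Set.mem_insert_iff, Set.mem_singleton_iff] at ha hx hy hd
  push Not at ha
  obtain ⟨h1, h2, h3, h4⟩ := ha
  by_contra! hne
  obtain ⟨hne, hne'⟩ := hne
  rcases hx with hx | hx | hx | hx | hx | hx | hx <;>
  rcases hy with hy | hy | hy | hy | hy | hy | hy <;>
  omega

theorem not_mem_admissibleValues_of_eq_one_or {a : ℤ} (ha : a ∉ ({-2, -1, 0, 1} : Set ℤ)) {x : ℤ}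
    (hx : x = 1 ∨ x = -1) : x ∉ admissibleValues a := by
  simp only [admissibleValues, Set.mem_insert_iff, Set.mem_singleton_iff] at *
  omega

section Bordered

variable {m : ℕ} {S : Set ℤ} {M : Matrix (Fin (m + 3)) (Fin (m + 2)) ℤ}

/-- All minors of order `m + 1` or `m + 2` of `M.snocOnes` that use the column of ones are
`0`, `1` or `-1`. -/
structure HasUnimodularBorderedMinors (M : Matrix (Fin (m + 3)) (Fin (m + 2)) ℤ) : Prop where
  corank_one : ∀ i j,
    |(M.submatrix (Fin.succAbove i) (Fin.succAbove j)).snocOnes.det| ≤ 1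
  corank_two : ∀ i j r l,
    |((M.submatrix (Fin.succAbove i) (Fin.succAbove j)).submatrix
      (Fin.succAbove r) (Fin.succAbove l)).snocOnes.det| ≤ 1

theorem HasUnimodularBorderedMinors.abs_adjugate_le (hM : HasUnimodularBorderedMinors M)
    (j : Fin (m + 2)) (i : Fin (m + 3)) : |M.snocOnes.adjugate j.castSucc i| ≤ 1 := by
  rw [Matrix.adjugate_fin_succ_eq_det_submatrix, abs_mul, abs_neg_one_pow, one_mul]
  rw [Matrix.snocOnes_submatrix_castSucc_succAbove]
  exact hM.corank_one i j

theorem HasUnimodularBorderedMinors.exists_adjugate_minor_eq (hM : HasUnimodularBorderedMinors M)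
    (j j' : Fin (m + 2)) (i i' : Fin (m + 3)) :
    ∃ c : ℤ, |c| ≤ 1 ∧ M.snocOnes.adjugate j.castSucc i * M.snocOnes.adjugate j'.castSucc i' -
      M.snocOnes.adjugate j.castSucc i' * M.snocOnes.adjugate j'.castSucc i =
        M.snocOnes.det * c := by
  by_cases hj : j = j'
  · exact ⟨0, by simp, by subst hj; ring⟩
  by_cases hi : i = i'
  · exact ⟨0, by simp, by subst hi; ring⟩
  obtain ⟨r, rfl⟩ := Fin.exists_succAbove_eq hi
  obtain ⟨l, rfl⟩ := Fin.exists_succAbove_eq hj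
  refine ⟨_, ?_, Matrix.adjugate_mul_adjugate_sub _ (by simp) _ _⟩
  rw [← Fin.castSucc_succAbove_castSucc, Matrix.adjugate_updateCol_single_eq,
    Matrix.snocOnes_submatrix_castSucc_succAbove, Matrix.snocOnes_submatrix_castSucc_succAbove]
  simpa [abs_mul] using hM.corank_two i' j' r l

theorem IsTotallySModular.adjugate_snocOnes_last_mem (hmod : IsTotallySModular S M)
    (hS : ∀ x ∈ S, -x ∈ S) (i : Fin (m + 3)) :
    M.snocOnes.adjugate (Fin.last _) i ∈ S := by
  rw [Matrix.adjugate_fin_succ_eq_det_submatrix, Matrix.snocOnes_submatrix_last_succAbove]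
  exact neg_one_pow_mul_mem hS _
    (hmod _ (by omega) (by omega) _ _ (Fin.strictMono_succAbove i) strictMono_id)

theorem IsTotallySModular.exists_adjugate_minor_last_eq (hmod : IsTotallySModular S M)
    (hS : ∀ x ∈ S, -x ∈ S) (j : Fin (m + 2)) {i i' : Fin (m + 3)} (hi : i ≠ i') :
    ∃ c ∈ S, M.snocOnes.adjugate j.castSucc i * M.snocOnes.adjugate (Fin.last _) i' -
      M.snocOnes.adjugate j.castSucc i' * M.snocOnes.adjugate (Fin.last _) i =
        M.snocOnes.det * c := by
  obtain ⟨r, rfl⟩ := Fin.exists_succAbove_eq hi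
  refine ⟨_, ?_, Matrix.adjugate_mul_adjugate_sub _ (Fin.castSucc_ne_last j) _ _⟩
  have := Matrix.adjugate_updateCol_single_eq M.snocOnes (Fin.last _) i' j r
  rw [Fin.succAbove_last] at this
  rw [this, ← Fin.succAbove_last, Matrix.snocOnes_submatrix_last_succAbove,
    Matrix.submatrix_submatrix]
  exact neg_one_pow_mul_mem hS _ (neg_one_pow_mul_mem hS _ (hmod _ (by omega) (by omega) _ _
    ((Fin.strictMono_succAbove i').comp (Fin.strictMono_succAbove r))
    (strictMono_id.comp (Fin.strictMono_succAbove j))))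

theorem Matrix.sum_adjugate_mul_apply {ι R : Type*} [Fintype ι] [DecidableEq ι] [CommRing R]
    (N : Matrix ι ι R) (i j : ι) :
    ∑ k, N.adjugate i k * N k j = if i = j then N.det else 0 := by
  have := congrFun (congrFun N.adjugate_mul i) j
  rw [Matrix.mul_apply] at this
  rw [this, Matrix.smul_apply, Matrix.one_apply]
  simp

theorem Matrix.sum_snocOnes_mul_adjugate {n : ℕ} (M : Matrix (Fin (n + 1)) (Fin n) ℤ)
    (k i : Fin (n + 1)) :
    ∑ j, M k j * M.snocOnes.adjugate j.castSucc i + M.snocOnes.adjugate (Fin.last n) i =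
      if k = i then M.snocOnes.det else 0 := by
  have := Matrix.sum_mul_adjugate_apply M.snocOnes k i
  rw [Fin.sum_univ_castSucc] at this
  simpa [Matrix.snocOnes_castSucc, Matrix.snocOnes_last] using this

/-- The entries of a column pair of the adjugate of `M.snocOnes` other than those in its last row
satisfy no relation `x + c * y = 0` unless the determinant vanishes. -/
theorem Matrix.exists_adjugate_snocOnes_add_mul_ne_zero (hD : M.snocOnes.det ≠ 0)
    {i i' : Fin (m + 3)} (hi : i ≠ i') (c : ℤ) :
    ∃ j : Fin (m + 2),
      M.snocOnes.adjugate j.castSucc i + c * M.snocOnes.adjugate j.castSucc i' ≠ 0 := by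
  by_contra! h
  have key (k : Fin (m + 3)) :
      M.snocOnes.adjugate (Fin.last _) i + c * M.snocOnes.adjugate (Fin.last _) i' =
        (if k = i then M.snocOnes.det else 0) + c * (if k = i' then M.snocOnes.det else 0) := by
    rw [← Matrix.sum_snocOnes_mul_adjugate, ← Matrix.sum_snocOnes_mul_adjugate, mul_add,
      Finset.mul_sum, add_add_add_comm, ← Finset.sum_add_distrib, Finset.sum_eq_zero, zero_add]
    intro j _
    linear_combination M k j * h j
  obtain ⟨k, hk⟩ : ∃ k, k ∉ ({i, i'} : Finset (Fin (m + 3))) := by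
    by_contra! hall
    have h3 : (Finset.univ : Finset (Fin (m + 3))).card ≤ 2 :=
      (Finset.card_le_card fun x _ => hall x).trans Finset.card_le_two
    simp at h3
  simp only [Finset.mem_insert, Finset.mem_singleton, not_or] at hk
  have h1 := key k
  have h2 := key i
  simp only [hk.1, hk.2, hi, if_true, if_false] at h1 h2
  exact hD (by linarith)

theorem Matrix.exists_adjugate_ne_zero {ι R : Type*} [Fintype ι] [DecidableEq ι] [CommRing R]
    {N : Matrix ι ι R} (hD : N.det ≠ 0) (j : ι) : ∃ i, N.adjugate j i ≠ 0 := by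
  by_contra! h
  have := N.sum_adjugate_mul_apply j j
  simp [h] at this
  exact hD this.symm

theorem HasUnimodularBorderedMinors.abs_det_le_two (hM : HasUnimodularBorderedMinors M) :
    |M.snocOnes.det| ≤ 2 := by
  by_contra! hlt
  have hD : M.snocOnes.det ≠ 0 := by
    intro h; simp [h] at hlt
  set A := M.snocOnes.adjugate with hA
  have hzero (j j' : Fin (m + 2)) (i i' : Fin (m + 3)) :
      A j.castSucc i * A j'.castSucc i' = A j.castSucc i' * A j'.castSucc i := by
    obtain ⟨c, -, h⟩ := hM.exists_adjugate_minor_eq j j' i i'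
    rw [← hA] at h
    have hb : |A j.castSucc i * A j'.castSucc i' - A j.castSucc i' * A j'.castSucc i| ≤ 2 := by
      refine (abs_sub _ _).trans ?_
      rw [abs_mul, abs_mul]
      have h1 := mul_le_one₀ (hM.abs_adjugate_le j i) (abs_nonneg _) (hM.abs_adjugate_le j' i')
      have h2 := mul_le_one₀ (hM.abs_adjugate_le j i') (abs_nonneg _) (hM.abs_adjugate_le j' i)
      linarith
    rw [h, abs_mul] at hb
    have hc : c = 0 := by
      by_contra hc
      have := Int.one_le_abs hc
      nlinarith
    rw [hc, mul_zero] at h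
    linarith
  obtain ⟨i', hi'⟩ := Matrix.exists_adjugate_ne_zero hD (0 : Fin (m + 2)).castSucc
  have h0 := M.snocOnes.sum_adjugate_mul_apply (0 : Fin (m + 2)).castSucc (1 : Fin (m + 2)).castSucc
  have h1 := M.snocOnes.sum_adjugate_mul_apply (1 : Fin (m + 2)).castSucc (1 : Fin (m + 2)).castSucc
  have hne : (0 : Fin (m + 2)).castSucc ≠ (1 : Fin (m + 2)).castSucc := by simp
  rw [if_neg hne] at h0
  rw [if_pos rfl] at h1
  apply mul_ne_zero hi' hD
  rw [← h1, ← mul_zero (A (1 : Fin (m + 2)).castSucc i'), ← h0, Finset.mul_sum, Finset.mul_sum]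
  refine Finset.sum_congr rfl fun k _ => ?_
  linear_combination M.snocOnes k (1 : Fin (m + 2)).castSucc * hzero 0 1 i' k

theorem HasUnimodularBorderedMinors.adjugate_eq_one_or (hM : HasUnimodularBorderedMinors M)
    (hD : |M.snocOnes.det| = 2) (j : Fin (m + 2)) (i : Fin (m + 3)) :
    M.snocOnes.adjugate j.castSucc i = 1 ∨ M.snocOnes.adjugate j.castSucc i = -1 := by
  have hD0 : M.snocOnes.det ≠ 0 := by
    intro h; simp [h] at hD
  obtain ⟨i', hi'⟩ := Matrix.exists_adjugate_ne_zero hD0 j.castSucc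
  obtain ⟨k, hk⟩ := exists_ne i
  obtain ⟨j', hj'⟩ := Matrix.exists_adjugate_snocOnes_add_mul_ne_zero hD0 hk.symm 0
  rw [zero_mul, add_zero] at hj'
  obtain ⟨c, -, h⟩ := hM.exists_adjugate_minor_eq j j' i i'
  have b1 := abs_le.1 (hM.abs_adjugate_le j i)
  have b2 := abs_le.1 (hM.abs_adjugate_le j i')
  have b3 := abs_le.1 (hM.abs_adjugate_le j' i)
  by_contra! hne
  have h0 : M.snocOnes.adjugate j.castSucc i = 0 := by omega
  have e2 : M.snocOnes.adjugate j.castSucc i' = 1 ∨ M.snocOnes.adjugate j.castSucc i' = -1 := by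
    omega
  have e3 : M.snocOnes.adjugate j'.castSucc i = 1 ∨ M.snocOnes.adjugate j'.castSucc i = -1 := by
    omega
  rw [h0] at h
  rcases (abs_eq (by norm_num)).1 hD with hd | hd <;> rcases e2 with e2 | e2 <;>
    rcases e3 with e3 | e3 <;> rw [hd, e2, e3] at h <;> omega

theorem even_sum_of_eq_one_or {ι : Type*} [Fintype ι] {f g : ι → ℤ}
    (hf : ∀ i, f i = 1 ∨ f i = -1) (hg : ∀ i, g i = 1 ∨ g i = -1) (h : Even (∑ i, f i)) :
    Even (∑ i, g i) := by
  have : Even (∑ i, (g i - f i)) := by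
    refine Finset.even_sum _ fun i _ => ?_
    rcases hf i with h | h <;> rcases hg i with h' | h' <;> rw [h, h'] <;> decide
  rw [Finset.sum_sub_distrib] at this
  simpa using this.add h

theorem IsTotallySModular.exists_two_mul_eq_adjugate_last_sub (hmod : IsTotallySModular S M)
    (hS : ∀ x ∈ S, -x ∈ S) (hM : HasUnimodularBorderedMinors M) (hD : |M.snocOnes.det| = 2)
    {i i' : Fin (m + 3)} (hi : i ≠ i') :
    ∃ s ∈ S, M.snocOnes.adjugate (Fin.last _) i - M.snocOnes.adjugate (Fin.last _) i' =
      2 * s := by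
  have hD0 : M.snocOnes.det ≠ 0 := by
    intro h; simp [h] at hD
  obtain ⟨j, hj⟩ := Matrix.exists_adjugate_snocOnes_add_mul_ne_zero hD0 hi 1
  obtain ⟨c, hc, h⟩ := hmod.exists_adjugate_minor_last_eq hS j hi
  have hc' := hS c hc
  suffices M.snocOnes.adjugate (Fin.last _) i - M.snocOnes.adjugate (Fin.last _) i' = 2 * c ∨
      M.snocOnes.adjugate (Fin.last _) i - M.snocOnes.adjugate (Fin.last _) i' = 2 * -c from
    this.elim (fun h => ⟨c, hc, h⟩) fun h => ⟨-c, hc', h⟩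
  rcases (abs_eq (by norm_num)).1 hD with hd | hd <;>
    rcases hM.adjugate_eq_one_or hD j i with e2 | e2 <;>
    rcases hM.adjugate_eq_one_or hD j i' with e3 | e3 <;>
    rw [e2, e3] at hj <;> rw [hd, e2, e3] at h <;> omega

theorem IsTotallySModular.abs_det_snocOnes_le_one {a : ℤ} (ha : a ∉ ({-2, -1, 0, 1} : Set ℤ))
    (hmod : IsTotallySModular (admissibleValues a) M) (hM : HasUnimodularBorderedMinors M) :
    |M.snocOnes.det| ≤ 1 := by
  by_contra! hlt
  have hD : |M.snocOnes.det| = 2 := by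
    have := hM.abs_det_le_two
    omega
  set w := M.snocOnes.adjugate (Fin.last _) with hw
  have hmem (i) : w i ∈ admissibleValues a :=
    hmod.adjugate_snocOnes_last_mem neg_mem_admissibleValues i
  have hsign (i) : ∃ ε : ℤ, (ε = 1 ∨ ε = -1) ∧ w i = ε * w 0 := by
    by_cases hi : i = 0
    · exact ⟨1, by simp [hi]⟩
    obtain ⟨d, hd, hd'⟩ :=
      hmod.exists_two_mul_eq_adjugate_last_sub neg_mem_admissibleValues hM hD hi
    rcases eq_or_eq_neg_of_mem_admissibleValues ha (hmem i) (hmem 0) hd hd' with h | h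
    · exact ⟨1, by simp [h]⟩
    · exact ⟨-1, by simp [h]⟩
  choose ε hε hwε using hsign
  have hrow := M.snocOnes.sum_adjugate_mul_apply (0 : Fin (m + 2)).castSucc (Fin.last _)
  have hlast := M.snocOnes.sum_adjugate_mul_apply (Fin.last _) (Fin.last _)
  rw [if_neg (Fin.castSucc_ne_last _)] at hrow
  rw [if_pos rfl] at hlast
  simp only [Matrix.snocOnes_last, mul_one] at hrow hlast
  obtain ⟨q, hq⟩ := even_sum_of_eq_one_or (hM.adjugate_eq_one_or hD 0) hε
    (by rw [hrow]; exact Even.zero)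
  rw [← hw, Finset.sum_congr rfl fun i _ => hwε i, ← Finset.sum_mul, hq] at hlast
  refine not_mem_admissibleValues_of_eq_one_or ha ?_ (hmem 0)
  apply Int.isUnit_iff.1
  rcases (abs_eq (by norm_num)).1 hD with hd | hd <;> rw [hd] at hlast
  · exact IsUnit.of_mul_eq_one q (by linarith)
  · exact IsUnit.of_mul_eq_one (-q) (by linarith)

end Bordered

theorem IsTotallySModular.abs_det_snocOnes_le_one_of_entries {a : ℤ}
    (ha : a ∉ ({-2, -1, 0, 1} : Set ℤ)) {n : ℕ} (M : Matrix (Fin (n + 1)) (Fin n) ℤ)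
    (hent : ∀ i j, M i j = a ∨ M i j = a + 1)
    (hmod : IsTotallySModular (admissibleValues a) M) : |M.snocOnes.det| ≤ 1 := by
  induction n using Nat.strong_induction_on with
  | _ n ih =>
    match n with
    | 0 =>
      have h0 : M.snocOnes 0 0 = 1 := M.snocOnes_last 0
      rw [Matrix.det_fin_one, h0, abs_one]
    | 1 =>
      have h0 (i) : M.snocOnes i 0 = M i 0 := M.snocOnes_castSucc i 0
      have h1 (i) : M.snocOnes i 1 = 1 := M.snocOnes_last i
      rw [Matrix.det_fin_two, h0, h0, h1, h1, abs_le]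
      have := hent 0 0
      have := hent 1 0
      omega
    | m + 2 =>
      refine hmod.abs_det_snocOnes_le_one ha ⟨fun i j => ?_, fun i j r l => ?_⟩
      · exact ih _ (by omega) _ (fun _ _ => hent _ _)
          (hmod.submatrix (Fin.strictMono_succAbove i) (Fin.strictMono_succAbove j))
      · exact ih _ (by omega) _ (fun _ _ => hent _ _)
          ((hmod.submatrix (Fin.strictMono_succAbove i) (Fin.strictMono_succAbove j)).submatrix
            (Fin.strictMono_succAbove r) (Fin.strictMono_succAbove l))

theorem stmt17 (a : ℤ) (ha : a ∉ ({-2, -1, 0, 1} : Set ℤ)) {n : ℕ} (hn : 2 ≤ n)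
    (M : Matrix (Fin n) (Fin (n - 1)) ℤ)
    (hent : ∀ i j, M i j = a ∨ M i j = a + 1)
    (hmod : IsTotallySModular
      ({0, a, -a, a + 1, -(a + 1), 2 * a + 1, -(2 * a + 1)} : Set ℤ) M)
    (N : Matrix (Fin n) (Fin n) ℤ)
    (hN : ∀ i j : Fin n,
      N i j = if h : (j : ℕ) < n - 1 then M i ⟨(j : ℕ), h⟩ else 1) :
    N.det ∈ ({-1, 0, 1} : Set ℤ) := by
  obtain ⟨k, rfl⟩ : ∃ k, n = k + 1 := ⟨n - 1, by omega⟩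
  have hNM : N = Matrix.snocOnes (n := k) M := by
    ext i j
    rw [hN]
    induction j using Fin.lastCases with
    | last => simp [Matrix.snocOnes_last]
    | cast j =>
      rw [Matrix.snocOnes_castSucc]
      simp
  have h := abs_le.1 (IsTotallySModular.abs_det_snocOnes_le_one_of_entries ha (n := k) M hent hmod)
  rw [← hNM] at h
  simp only [Set.mem_insert_iff, Set.mem_singleton_iff]
  omega
end

section
/- Let S = {0, X, −X, X+1, −(X+1)} ⊆ ℤ[X] and let M be an m×n matrix over ℤ[X] each of whose entries equals X or X+1. Then M is totally S-modular if and only if there do not exist row indices i₁ < i₂ and column indices j₁ < j₂ such that either (M i₁ j₁ = X+1, M i₂ j₂ = X+1, M i₁ j₂ = X, M i₂ j₁ = X) or (M i₁ j₁ = X, M i₂ j₂ = X, M i₁ j₂ = X+1, M i₂ j₁ = X+1). -/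
open Polynomial Matrix

/-- The matrix with entry `x + 1` at `(i, j)` if `j ∈ A i`, and `x` otherwise. -/
def shiftedIncidence {R : Type*} [CommRing R] {k l : ℕ} (x : R) (A : Fin k → Finset (Fin l)) :
    Matrix (Fin k) (Fin l) R :=
  Matrix.of fun i j => if j ∈ A i then x + 1 else x

/-- If the rows of a square shifted incidence matrix form a chain of sets, its determinant is
`0`, `±x` or `±(x + 1)`. -/
theorem det_shiftedIncidence_mem_of_chain {R : Type*} [CommRing R] (x : R) :
    ∀ (k : ℕ) (A : Fin (k + 1) → Finset (Fin (k + 1))),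
      (∀ i i', A i ⊆ A i' ∨ A i' ⊆ A i) →
      (shiftedIncidence x A).det ∈ ({0, x, -x, x + 1, -(x + 1)} : Set R) := by
  intro k
  induction k with
  | zero =>
    intro A _
    by_cases h : (0 : Fin 1) ∈ A 0 <;> simp [shiftedIncidence, h]
  | succ k ih =>
    intro A hA
    have subset_of_card_le : ∀ i i', (A i).card ≤ (A i').card → A i ⊆ A i' := by
      intro i i' h
      rcases hA i i' with h' | h'
      · exact h'
      · exact (Finset.eq_of_subset_of_card_le h' h).ge
    obtain ⟨a, ha⟩ := Finite.exists_max (fun i => (A i).card)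
    obtain ⟨b, hb, hbmax⟩ := (Finset.univ.erase a).exists_max_image (fun i => (A i).card)
      (by rw [← Finset.card_pos, Finset.card_erase_of_mem (Finset.mem_univ a)]; simp)
    have hba : b ≠ a := Finset.ne_of_mem_erase hb
    have hbA : A b ⊆ A a := subset_of_card_le _ _ (ha b)
    have hother : ∀ i, i ≠ a → A i ⊆ A b := fun i hi =>
      subset_of_card_le _ _ (hbmax i (by simp [hi]))
    by_cases heq : A a ⊆ A b
    · left
      refine det_zero_of_row_eq hba ?_
      have : A b = A a := hbA.antisymm heq
      ext j
      simp [shiftedIncidence, this]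
    obtain ⟨c, hca, hcb⟩ := Finset.not_subset.1 heq
    by_cases hdup : ∃ c', c' ≠ c ∧ c' ∈ A a ∧ c' ∉ A b
    · obtain ⟨c', hne, hca', hcb'⟩ := hdup
      left
      refine det_zero_of_column_eq hne fun i => ?_
      by_cases hi : i = a
      · subst hi
        simp [shiftedIncidence, hca, hca']
      · have h1 : c ∉ A i := fun h => hcb (hother i hi h)
        have h2 : c' ∉ A i := fun h => hcb' (hother i hi h)
        simp [shiftedIncidence, h1, h2]
    push Not at hdup
    have hrow : shiftedIncidence x A a + (-1 : R) • shiftedIncidence x A b = Pi.single c 1 := by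
      ext j
      by_cases hj : j = c
      · subst hj
        simp [shiftedIncidence, hca, hcb]
      · have : j ∈ A a ↔ j ∈ A b := ⟨hdup j hj, fun h => hbA h⟩
        simp [shiftedIncidence, this, hj]
    have hminor : (shiftedIncidence x A).submatrix a.succAbove c.succAbove =
        shiftedIncidence x fun i =>
          Finset.univ.filter fun j => c.succAbove j ∈ A (a.succAbove i) := by
      ext i j
      simp [shiftedIncidence]
    have hdet : (shiftedIncidence x A).det = (-1) ^ (a + c : ℕ) *
        (shiftedIncidence x fun i =>
          Finset.univ.filter fun j => c.succAbove j ∈ A (a.succAbove i)).det := by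
      rw [← det_updateRow_add_smul_self _ hba.symm (-1), hrow, ← adjugate_apply,
        adjugate_fin_succ_eq_det_submatrix, hminor]
    have hmem := ih (fun i => Finset.univ.filter fun j => c.succAbove j ∈ A (a.succAbove i))
      fun i i' => (hA (a.succAbove i) (a.succAbove i')).imp
        (fun h j => by simpa using @h _) (fun h j => by simpa using @h _)
    rw [hdet]
    simp only [Set.mem_insert_iff, Set.mem_singleton_iff] at hmem ⊢
    rcases neg_one_pow_eq_or R (a + c : ℕ) with h | h <;>
      rcases hmem with e | e | e | e | e <;> rw [h, e] <;> simp

theorem two_mul_X_add_one_notMem :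
    (2 * X + 1 : ℤ[X]) ∉ ({0, X, -X, X + 1, -(X + 1)} : Set ℤ[X]) := by
  intro h
  simp only [Set.mem_insert_iff, Set.mem_singleton_iff] at h
  rcases h with h | h | h | h | h <;> have := congrArg (eval 1) h <;> norm_num at this

theorem neg_two_mul_X_add_one_notMem :
    (-(2 * X + 1) : ℤ[X]) ∉ ({0, X, -X, X + 1, -(X + 1)} : Set ℤ[X]) := by
  intro h
  simp only [Set.mem_insert_iff, Set.mem_singleton_iff] at h
  rcases h with h | h | h | h | h <;> have := congrArg (eval 1) h <;> norm_num at this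

theorem stmt18 {m n : ℕ} (M : Matrix (Fin m) (Fin n) (Polynomial ℤ))
    (hent : ∀ i j, M i j = X ∨ M i j = X + 1) :
    IsTotallySModular ({0, X, -X, X + 1, -(X + 1)} : Set (Polynomial ℤ)) M ↔
      ¬ ∃ i₁ i₂ : Fin m, ∃ j₁ j₂ : Fin n, i₁ < i₂ ∧ j₁ < j₂ ∧
        ((M i₁ j₁ = X + 1 ∧ M i₂ j₂ = X + 1 ∧ M i₁ j₂ = X ∧ M i₂ j₁ = X) ∨
         (M i₁ j₁ = X ∧ M i₂ j₂ = X ∧ M i₁ j₂ = X + 1 ∧ M i₂ j₁ = X + 1)) := by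
  constructor
  · rintro hM ⟨i₁, i₂, j₁, j₂, hi, hj, h⟩
    have hdet := hM 2 (by norm_num) (by lia) ![i₁, i₂] ![j₁, j₂]
      (by simpa [Fin.strictMono_iff_lt_succ] using hi)
      (by simpa [Fin.strictMono_iff_lt_succ] using hj)
    rw [det_fin_two] at hdet
    rcases h with ⟨h1, h2, h3, h4⟩ | ⟨h1, h2, h3, h4⟩
    · apply two_mul_X_add_one_notMem
      convert hdet using 1
      simp only [submatrix_apply, cons_val_zero, cons_val_one, h1, h2, h3, h4]
      ring
    · apply neg_two_mul_X_add_one_notMem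
      convert hdet using 1
      simp only [submatrix_apply, cons_val_zero, cons_val_one, h1, h2, h3, h4]
      ring
  · classical
    intro hno k hk _ f g _ _
    obtain ⟨k, rfl⟩ : ∃ l, k = l + 1 := ⟨k - 1, by lia⟩
    have hsub : M.submatrix f g =
        shiftedIncidence X fun i => Finset.univ.filter fun j => M (f i) (g j) = X + 1 := by
      refine Matrix.ext fun i j => ?_
      rcases hent (f i) (g j) with h | h <;> simp [shiftedIncidence, h]
    rw [hsub]
    refine det_shiftedIncidence_mem_of_chain X k _ fun i i' => ?_
    by_contra! hcon
    obtain ⟨j, hj, hj'⟩ := Finset.not_subset.1 hcon.1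
    obtain ⟨l, hl', hl⟩ := Finset.not_subset.1 hcon.2
    simp only [Finset.mem_filter, Finset.mem_univ, true_and] at hj hj' hl hl'
    replace hj' := (hent _ _).resolve_right hj'
    replace hl := (hent _ _).resolve_right hl
    have hX : (X : ℤ[X]) ≠ X + 1 := by simp
    have hii : f i ≠ f i' := fun h => hX (hj'.symm.trans (h ▸ hj))
    have hjl : g j ≠ g l := fun h => hX (hl.symm.trans (h ▸ hj))
    rcases hii.lt_or_gt with h | h <;> rcases hjl.lt_or_gt with h' | h'
    · exact hno ⟨_, _, _, _, h, h', .inl ⟨hj, hl', hl, hj'⟩⟩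
    · exact hno ⟨_, _, _, _, h, h', .inr ⟨hl, hj', hj, hl'⟩⟩
    · exact hno ⟨_, _, _, _, h, h', .inr ⟨hj', hl, hl', hj⟩⟩
    · exact hno ⟨_, _, _, _, h, h', .inl ⟨hl', hj, hj', hl⟩⟩
end

section
/- Let S = {0, X, −X} ⊆ ℤ[X], let n ≥ 2, and let M be an n×n matrix over ℤ[X] that is totally S-modular. Then det M = 0; in particular, there is no invertible totally S-modular square matrix of dimension larger than one. -/
open Polynomial Matrix

theorem stmt19 {n : ℕ} (hn : 2 ≤ n) (M : Matrix (Fin n) (Fin n) (Polynomial ℤ))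
    (hmod : IsTotallySModular ({0, X, -X} : Set (Polynomial ℤ)) M) :
    M.det = 0 := by
  have hdvd : ∀ i j, (X : Polynomial ℤ) ∣ M i j := by
    intro i j
    have h := hmod 1 le_rfl (by omega) (fun _ => i) (fun _ => j)
      (Subsingleton.strictMono _) (Subsingleton.strictMono _)
    rw [det_fin_one, submatrix_apply] at h
    rcases h with h | h | h <;> rw [h] <;> simp
  choose N hN using hdvd
  have hM : M = (X : Polynomial ℤ) • Matrix.of N := by
    ext1 i j
    simp [hN]
  have hsq : (X : Polynomial ℤ) ^ 2 ∣ M.det := by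
    rw [hM, det_smul, Fintype.card_fin]
    exact (pow_dvd_pow X hn).mul_right _
  have hX : ¬ (X : Polynomial ℤ) ^ 2 ∣ X := by
    rw [X_pow_dvd_iff]
    intro h
    simpa using h 1 one_lt_two
  have hdet := hmod n (by omega) (by simp) id id strictMono_id strictMono_id
  rw [submatrix_id_id] at hdet
  rcases hdet with h | h | h
  · exact h
  · exact absurd (h ▸ hsq) hX
  · exact absurd ((dvd_neg).mp (h ▸ hsq)) hX
end
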